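/- There exist universal constants a, C > 0 such that the following holds (pseudorandom functions are noise sensitive). Let (X,Π) be a two-sided γ-local-spectral expander, let ρ, ε ∈ (0,1), let r be an integer with r ≥ log(2/ε)/log(1/ρ) + 2, and let f ∈ C_k be a Boolean ({0,1}-valued), (δ,r)-pseudorandom function with δ ≤ 2^{−a·r}·ε³. Then Stab_ρ(f) ≤ (ε + 2^{C·k}·γ)·E[f]. -/

import Mathlib

open Finset

/-- Functions on faces of a complex on vertex set `Fin n`. -/
abbrev Cf (n : ℕ) := Finset (Fin n) → ℝ

/-- A `d`-dimensional weighted pure simplicial complex on vertex set `Fin n`: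
the downward closure of a `d`-uniform hypergraph `faces d`, together with a
probability distribution on the top faces inducing distributions `w i` on each
level `faces i` via `π_i(x) = (1/(i+1))·Σ_{y ⊃ x} π_{i+1}(y)`. -/
structure WSC (n d : ℕ) where
  faces : ℕ → Finset (Finset (Fin n))
  top_nonempty : (faces d).Nonempty
  card_mem : ∀ i, ∀ s ∈ faces i, s.card = i
  empty_levels : ∀ i, d < i → faces i = ∅
  downward : ∀ i, i < d → ∀ s : Finset (Fin n),
    s ∈ faces i ↔ (s.card = i ∧ ∃ t ∈ faces (i+1), s ⊆ t)
  w : ℕ → Finset (Fin n) → ℝ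
  w_nonneg : ∀ i s, 0 ≤ w i s
  w_pos : ∀ i, ∀ s ∈ faces i, 0 < w i s
  w_zero : ∀ i s, s ∉ faces i → w i s = 0
  w_top_sum : ∑ s ∈ faces d, w d s = 1
  w_rec : ∀ i, i < d → ∀ s ∈ faces i,
    w i s = (1/(i+1 : ℝ)) * ∑ t ∈ (faces (i+1)).filter (fun t => s ⊆ t), w (i+1) t

variable {n d : ℕ}

/-- The up operator `U_k : C_k → C_{k+1}`. -/
noncomputable def Uop (X : WSC n d) (k : ℕ) (f : Cf n) : Cf n := fun τ =>
  (1/(k+1 : ℝ)) * ∑ σ ∈ (X.faces k).filter (fun σ => σ ⊆ τ), f σ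

/-- The down operator `D_{k+1} : C_{k+1} → C_k`. -/
noncomputable def Dop (X : WSC n d) (k : ℕ) (f : Cf n) : Cf n := fun τ =>
  (∑ σ ∈ (X.faces (k+1)).filter (fun σ => τ ⊆ σ), X.w (k+1) σ * f σ) /
  (∑ σ ∈ (X.faces (k+1)).filter (fun σ => τ ⊆ σ), X.w (k+1) σ)

/-- `Uc X i m : C_i → C_{i+m}` is the iterated up operator; `U_i^k = Uc X i (k-i)`. -/
noncomputable def Uc (X : WSC n d) (i : ℕ) : ℕ → Cf n → Cf n
  | 0, f => f
  | m+1, f => Uop X (i+m) (Uc X i m f)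

/-- `Dc X k m : C_k → C_{k-m}` is the iterated down operator; `D_i^k = Dc X k (k-i)`. -/
noncomputable def Dc (X : WSC n d) (k : ℕ) : ℕ → Cf n → Cf n
  | 0, f => f
  | m+1, f => Dop X (k - (m+1)) (Dc X k m f)

/-- Bottom-Up level functions: `g_i = D_i^k f − Σ_{j<i} C(i,j)·U_j^i g_j ∈ C_i`. -/
noncomputable def gLevel (X : WSC n d) (k : ℕ) (f : Cf n) : ℕ → Cf n
  | i => Dc X k (k - i) f - ∑ j ∈ (Finset.range i).attach,
      ((i.choose j.1 : ℝ)) • Uc X j.1 (i - j.1) (gLevel X k f j.1)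
  termination_by i => i
  decreasing_by exact Finset.mem_range.mp j.2

/-- Lifted Bottom-Up level functions: `f_i^↑ = C(k,i)·U_i^k g_i ∈ C_k`. -/
noncomputable def fLevel (X : WSC n d) (k : ℕ) (f : Cf n) (i : ℕ) : Cf n :=
  ((k.choose i : ℝ)) • Uc X i (k - i) (gLevel X k f i)

/-- Inner product at level `i`: `⟨f,g⟩ = E_{τ∼π_i}[f(τ)g(τ)]`. -/
noncomputable def ip (X : WSC n d) (i : ℕ) (f g : Cf n) : ℝ :=
  ∑ τ ∈ X.faces i, X.w i τ * f τ * g τ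

/-- Expectation at level `i`. -/
noncomputable def EE (X : WSC n d) (i : ℕ) (f : Cf n) : ℝ :=
  ∑ τ ∈ X.faces i, X.w i τ * f τ

/-- `L²` norm at level `i`. -/
noncomputable def norm2 (X : WSC n d) (i : ℕ) (f : Cf n) : ℝ := Real.sqrt (ip X i f f)

/-- `L^p` norm at level `i`. -/
noncomputable def normP (X : WSC n d) (i : ℕ) (p : ℝ) (f : Cf n) : ℝ :=
  (∑ τ ∈ X.faces i, X.w i τ * |f τ| ^ p) ^ (1/p)

/-- `L^∞` norm at level `i` : the maximum of `|f|` over `i`-faces. -/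
noncomputable def normInf (X : WSC n d) (i : ℕ) (f : Cf n) : ℝ :=
  ⨆ τ : {σ // σ ∈ X.faces i}, |f τ.1|

/-- `E_{X_τ}[f|_τ]`: the weighted mean of `f ∈ C_k` over `k`-faces containing `τ`. -/
noncomputable def linkMean (X : WSC n d) (k : ℕ) (τ : Finset (Fin n)) (f : Cf n) : ℝ :=
  (∑ ρ ∈ (X.faces k).filter (fun ρ => τ ⊆ ρ), X.w k ρ * f ρ) /
  (∑ ρ ∈ (X.faces k).filter (fun ρ => τ ⊆ ρ), X.w k ρ)

/-- `⟨f|_τ, g|_τ⟩` over the link `X_τ` with its induced distribution, for `f, g ∈ C_k`. -/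
noncomputable def linkIp (X : WSC n d) (k : ℕ) (τ : Finset (Fin n)) (f g : Cf n) : ℝ :=
  (∑ ρ ∈ (X.faces k).filter (fun ρ => τ ⊆ ρ), X.w k ρ * f ρ * g ρ) /
  (∑ ρ ∈ (X.faces k).filter (fun ρ => τ ⊆ ρ), X.w k ρ)

/-- `f ∈ C_k` is `(ε,i)`-pseudorandom: `|E_{X_τ}[f|_τ]| ≤ ε‖f‖_∞` and
`⟨f|_τ,f|_τ⟩ ≤ ε‖f‖_∞²` for every `i`-face `τ`. -/
def Pseudorandom (X : WSC n d) (k : ℕ) (ε : ℝ) (i : ℕ) (f : Cf n) : Prop :=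
  ∀ τ ∈ X.faces i, |linkMean X k τ f| ≤ ε * normInf X k f ∧
    linkIp X k τ f f ≤ ε * (normInf X k f)^2

/-- Boolean ({0,1}-valued) function on `X(k)`. -/
def IsBool (X : WSC n d) (k : ℕ) (f : Cf n) : Prop := ∀ τ ∈ X.faces k, f τ = 0 ∨ f τ = 1

/-- Total influence `I[f] = ⟨f, k(Id − U_{k−1}D_k) f⟩`. -/
noncomputable def influence (X : WSC n d) (k : ℕ) (f : Cf n) : ℝ :=
  (k : ℝ) * (ip X k f f - ip X k f (Uop X (k-1) (Dop X (k-1) f)))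

/-- Variance `Var(f) = E[f²] − E[f]²`. -/
noncomputable def variance (X : WSC n d) (k : ℕ) (f : Cf n) : ℝ :=
  ip X k f f - (EE X k f)^2

/-- The noise operator `T_ρ = Σ_{i=0}^k C(k,i)(1−ρ)^i ρ^{k−i} U_{k−i}^k D_{k−i}^k`. -/
noncomputable def noiseOp (X : WSC n d) (k : ℕ) (ρ : ℝ) (f : Cf n) : Cf n :=
  ∑ i ∈ Finset.range (k+1),
    ((k.choose i : ℝ) * (1-ρ)^i * ρ^(k-i)) • Uc X (k-i) i (Dc X k i f)

/-- Noise stability `Stab_ρ(f) = ⟨f, T_ρ f⟩`. -/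
noncomputable def stab (X : WSC n d) (k : ℕ) (ρ : ℝ) (f : Cf n) : ℝ :=
  ip X k f (noiseOp X k ρ f)

/-- Edge weights of the underlying graph of the link of `s ∈ X(i)`. -/
noncomputable def edgeW (X : WSC n d) (i : ℕ) (s : Finset (Fin n)) (u v : Fin n) : ℝ :=
  if u ≠ v ∧ u ∉ s ∧ v ∉ s ∧ insert u (insert v s) ∈ X.faces (i+2)
  then X.w (i+2) (insert u (insert v s)) else 0

/-- Vertex weights of the underlying graph of the link of `s ∈ X(i)`. -/
noncomputable def vertW (X : WSC n d) (i : ℕ) (s : Finset (Fin n)) (u : Fin n) : ℝ :=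
  ∑ v, edgeW X i s u v

/-- `X` is a two-sided `γ`-local-spectral expander: for every `i ≤ d−2` and every
`s ∈ X(i)` (including `s = ∅`), every nontrivial eigenvalue of the weighted adjacency
operator of the graph `(X_s(1), X_s(2))` has absolute value at most `γ`, expressed via
the quadratic form on functions orthogonal to constants. -/
def IsLSE (X : WSC n d) (γ : ℝ) : Prop :=
  ∀ i, i + 2 ≤ d → ∀ s ∈ X.faces i, ∀ f : Fin n → ℝ,
    (∑ u, vertW X i s u * f u) = 0 →
    |∑ u, ∑ v, edgeW X i s u v * f u * f v| ≤ γ * ∑ u, vertW X i s u * (f u)^2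

/-- The swap walk `S_{j,i} : C_i → C_j`: `(S_{j,i} f)(τ)` is the weighted mean of `f(σ)`
over `i`-faces `σ` disjoint from `τ` with `τ ∪ σ ∈ X(i+j)`. -/
noncomputable def swapW (X : WSC n d) (j i : ℕ) (f : Cf n) : Cf n := fun τ =>
  (∑ σ ∈ (X.faces i).filter (fun σ => Disjoint σ τ ∧ σ ∪ τ ∈ X.faces (i+j)),
      X.w (i+j) (σ ∪ τ) * f σ) /
  (∑ σ ∈ (X.faces i).filter (fun σ => Disjoint σ τ ∧ σ ∪ τ ∈ X.faces (i+j)),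
      X.w (i+j) (σ ∪ τ))

/-- Localized mean: `E_{σ ∼ π_{v,i}}[f(σ)]`, the mean of `f ∈ C_i` over the `i`-faces of
the link `X_v` of `v ∈ X(j)`, with respect to the distribution induced by the link. -/
noncomputable def locMean (X : WSC n d) (i j : ℕ) (v : Finset (Fin n)) (f : Cf n) : ℝ :=
  (∑ σ ∈ (X.faces i).filter (fun σ => Disjoint σ v ∧ σ ∪ v ∈ X.faces (i+j)),
      X.w (i+j) (σ ∪ v) * f σ) /
  (∑ σ ∈ (X.faces i).filter (fun σ => Disjoint σ v ∧ σ ∪ v ∈ X.faces (i+j)),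
      X.w (i+j) (σ ∪ v))

/-- The `m`-faces of the link `X_τ`. -/
noncomputable def lkFaces (X : WSC n d) (τ : Finset (Fin n)) (m : ℕ) : Finset (Finset (Fin n)) :=
  (Finset.univ : Finset (Finset (Fin n))).filter
    (fun σ => Disjoint σ τ ∧ σ ∪ τ ∈ X.faces (τ.card + m))

/-- Inner product at level `m` of the link `X_τ` (with the induced distribution). -/
noncomputable def lkIp (X : WSC n d) (τ : Finset (Fin n)) (m : ℕ) (f g : Cf n) : ℝ :=
  (∑ σ ∈ lkFaces X τ m, X.w (τ.card + m) (σ ∪ τ) * f σ * g σ) /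
  (∑ σ ∈ lkFaces X τ m, X.w (τ.card + m) (σ ∪ τ))

/-- `L²` norm at level `m` of the link `X_τ`. -/
noncomputable def lkNorm2 (X : WSC n d) (τ : Finset (Fin n)) (m : ℕ) (f : Cf n) : ℝ :=
  Real.sqrt (lkIp X τ m f f)

/-- Global mean at level `m` of the link `X_τ` (the stationary operator `U_0^j D_0^m`
of the swap walk on `X_τ` applied to `f`). -/
noncomputable def lkMeanLvl (X : WSC n d) (τ : Finset (Fin n)) (m : ℕ) (f : Cf n) : ℝ :=
  (∑ σ ∈ lkFaces X τ m, X.w (τ.card + m) (σ ∪ τ) * f σ) /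
  (∑ σ ∈ lkFaces X τ m, X.w (τ.card + m) (σ ∪ τ))

/-- The swap walk `S_{j,m}` within the link `X_τ`. -/
noncomputable def lkSwap (X : WSC n d) (τ : Finset (Fin n)) (j m : ℕ) (f : Cf n) : Cf n := fun v =>
  (∑ σ ∈ (lkFaces X τ m).filter (fun σ => Disjoint σ v ∧ σ ∪ v ∈ lkFaces X τ (m+j)),
      X.w (τ.card + m + j) (σ ∪ v ∪ τ) * f σ) /
  (∑ σ ∈ (lkFaces X τ m).filter (fun σ => Disjoint σ v ∧ σ ∪ v ∈ lkFaces X τ (m+j)),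
      X.w (τ.card + m + j) (σ ∪ v ∪ τ))

/-- Restriction `f|_τ(σ) = f(τ ∪ σ)`. -/
def restrictF (τ : Finset (Fin n)) (f : Cf n) : Cf n := fun σ => f (τ ∪ σ)

/-- The Bottom-Up level function of the restriction `f|_υ` computed within the link
`X_υ` (via its explicit form): `g_ℓ^{(υ)}(I) = Σ_{T ⊆ I} (−1)^{|I∖T|}·E_{(X_υ)_T}[f|_υ]`. -/
noncomputable def gLink (X : WSC n d) (k : ℕ) (f : Cf n) (υ : Finset (Fin n)) : Cf n :=
  fun I => ∑ σ ∈ I.powerset, (-1:ℝ)^((I \ σ).card) * linkMean X k (υ ∪ σ) f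

section SignedSums

variable {α E : Type*} [DecidableEq α] [AddCommGroup E] [Module ℝ E]

theorem sum_powerset_insert_sign (e : Finset α → E) {v : α} {S : Finset α} (hv : v ∉ S) :
    ∑ T ∈ (insert v S).powerset, (-1 : ℝ) ^ #(insert v S \ T) • e T =
      ∑ T ∈ S.powerset, (-1 : ℝ) ^ #(S \ T) • (e (insert v T) - e T) := by
  rw [sum_powerset_insert hv, ← sum_add_distrib]
  refine sum_congr rfl fun T hT => ?_
  have hvT : v ∉ T := fun h => hv (mem_powerset.1 hT h)
  have h1 : #(insert v S \ T) = #(S \ T) + 1 := by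
    rw [insert_sdiff_of_notMem _ hvT, card_insert_of_notMem (by simp [hv])]
  have h2 : insert v S \ insert v T = S \ T := by
    ext a; simp only [mem_sdiff, mem_insert]
    by_cases h : a = v
    · subst h; simp [hv]
    · simp [h]
  rw [h1, h2, pow_succ, smul_sub]
  simp only [mul_neg, mul_one, neg_smul]
  abel

theorem sum_powerset_sign_eq_zero (e : Finset α → E) {v : α} {S : Finset α} (hv : v ∈ S)
    (he : ∀ T, e (insert v T) = e T) :
    ∑ T ∈ S.powerset, (-1 : ℝ) ^ #(S \ T) • e T = 0 := by
  rw [← insert_erase hv, sum_powerset_insert_sign e (notMem_erase v S)]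
  simp [he]

theorem sum_powerset_pow_smul_sum_sign (ρ : ℝ) (e : Finset α → E) (Y : Finset α) :
    ∑ S ∈ Y.powerset, ρ ^ #S • ∑ T ∈ S.powerset, (-1 : ℝ) ^ #(S \ T) • e T =
      ∑ T ∈ Y.powerset, (ρ ^ #T * (1 - ρ) ^ #(Y \ T)) • e T := by
  induction Y using Finset.induction_on generalizing e with
  | empty => simp
  | insert v Y hv ih =>
    have key := ih (fun T => (1 - ρ) • e T + ρ • e (insert v T))
    rw [sum_powerset_insert hv, sum_powerset_insert hv, ← sum_add_distrib, ← sum_add_distrib]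
    convert key using 1
    · refine sum_congr rfl fun S hS => ?_
      have hvS : v ∉ S := fun h => hv (mem_powerset.1 hS h)
      rw [sum_powerset_insert_sign e hvS, card_insert_of_notMem hvS, smul_sum, smul_sum,
        smul_sum, ← sum_add_distrib]
      refine sum_congr rfl fun T _ => ?_
      module
    · refine sum_congr rfl fun T hT => ?_
      have hvT : v ∉ T := fun h => hv (mem_powerset.1 hT h)
      have h1 : #(insert v Y \ T) = #(Y \ T) + 1 := by
        rw [insert_sdiff_of_notMem _ hvT, card_insert_of_notMem (by simp [hv])]
      have h2 : insert v Y \ insert v T = Y \ T := by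
        ext a; simp only [mem_sdiff, mem_insert]
        by_cases h : a = v
        · subst h; simp [hv]
        · simp [h]
      rw [h1, h2, card_insert_of_notMem hvT]
      module

end SignedSums

theorem pi_mul_self_nonneg {Ω : Type*} (h : Ω → ℝ) : 0 ≤ h * h := fun ω => mul_self_nonneg (h ω)

/-- A finite weighted space with conditional expectations indexed by sets of coordinates. -/
structure CondSystem (Ω : Type*) [Fintype Ω] (k : ℕ) where
  μ : Ω → ℝ
  μ_nonneg : ∀ ω, 0 ≤ μ ω
  cond : Finset (Fin k) → (Ω → ℝ) →ₗ[ℝ] (Ω → ℝ)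
  cond_symm : ∀ S g h, ∑ ω, μ ω * (g ω * cond S h ω) = ∑ ω, μ ω * (cond S g ω * h ω)
  cond_cond_of_subset : ∀ {S T} (h), S ⊆ T → cond S (cond T h) = cond S h
  cond_cond_of_superset : ∀ {S T} (h), S ⊆ T → cond T (cond S h) = cond S h
  cond_mul_cond : ∀ S g h, cond S (g * cond S h) = cond S g * cond S h
  cond_nonneg : ∀ S h, 0 ≤ h → 0 ≤ cond S h
  cond_one : ∀ S, cond S 1 = 1
  cond_univ : ∀ h, cond univ h = h

namespace CondSystem

variable {Ω : Type*} [Fintype Ω] {k : ℕ} (M : CondSystem Ω k)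

/-- Expectation. -/
noncomputable def ex : (Ω → ℝ) →ₗ[ℝ] ℝ := ∑ ω, M.μ ω • LinearMap.proj ω

/-- The `L²` norm. -/
noncomputable def nrm (h : Ω → ℝ) : ℝ := √(M.ex (h * h))

theorem ex_apply (h : Ω → ℝ) : M.ex h = ∑ ω, M.μ ω * h ω := by simp [ex]

theorem ex_nonneg {h : Ω → ℝ} (hh : 0 ≤ h) : 0 ≤ M.ex h := by
  rw [ex_apply]; exact sum_nonneg fun ω _ => mul_nonneg (M.μ_nonneg ω) (hh ω)

theorem ex_mono {g h : Ω → ℝ} (hh : g ≤ h) : M.ex g ≤ M.ex h := by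
  rw [ex_apply, ex_apply]
  exact sum_le_sum fun ω _ => mul_le_mul_of_nonneg_left (hh ω) (M.μ_nonneg ω)

theorem ex_mul_cond (S : Finset (Fin k)) (g h : Ω → ℝ) :
    M.ex (g * M.cond S h) = M.ex (M.cond S g * h) := by
  simp only [ex_apply, Pi.mul_apply]; exact M.cond_symm S g h

theorem ex_cond (S : Finset (Fin k)) (h : Ω → ℝ) : M.ex (M.cond S h) = M.ex h := by
  have := M.ex_mul_cond S 1 h
  simpa [M.cond_one] using this

theorem cond_cond (S : Finset (Fin k)) (h : Ω → ℝ) : M.cond S (M.cond S h) = M.cond S h :=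
  M.cond_cond_of_subset h Subset.rfl

theorem cond_mono (S : Finset (Fin k)) {g h : Ω → ℝ} (hh : g ≤ h) : M.cond S g ≤ M.cond S h := by
  have := M.cond_nonneg S (h - g) (sub_nonneg.2 hh)
  rw [map_sub] at this
  exact sub_nonneg.1 this

theorem cond_le_const (S : Finset (Fin k)) {h : Ω → ℝ} {c : ℝ} (hh : ∀ ω, h ω ≤ c) (ω : Ω) :
    M.cond S h ω ≤ c := by
  have := M.cond_mono S (g := h) (h := c • 1) (fun ω => by simpa using hh ω) ω
  simpa [M.cond_one] using this

theorem nrm_sq (h : Ω → ℝ) : M.nrm h ^ 2 = M.ex (h * h) :=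
  Real.sq_sqrt (M.ex_nonneg (pi_mul_self_nonneg h))

theorem nrm_nonneg (h : Ω → ℝ) : 0 ≤ M.nrm h := Real.sqrt_nonneg _

theorem ex_mul_sq_le (g h : Ω → ℝ) : M.ex (g * h) ^ 2 ≤ M.ex (g * g) * M.ex (h * h) := by
  have key := discrim_le_zero (a := M.ex (g * g)) (b := 2 * M.ex (g * h)) (c := M.ex (h * h)) (by
    intro x
    have h0 := M.ex_nonneg (pi_mul_self_nonneg (x • g + h))
    have : (x • g + h) * (x • g + h) = (x * x) • (g * g) + (2 * x) • (g * h) + h * h := by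
      ext ω; simp only [Pi.mul_apply, Pi.add_apply, Pi.smul_apply, smul_eq_mul]; ring
    rw [this] at h0
    simp only [map_add, map_smul, smul_eq_mul] at h0
    linarith)
  unfold discrim at key
  nlinarith

theorem abs_ex_mul_le (g h : Ω → ℝ) : |M.ex (g * h)| ≤ M.nrm g * M.nrm h := by
  apply abs_le_of_sq_le_sq _ (mul_nonneg (M.nrm_nonneg _) (M.nrm_nonneg _))
  rw [mul_pow, nrm_sq, nrm_sq]; exact M.ex_mul_sq_le g h

theorem ex_mul_le (g h : Ω → ℝ) : M.ex (g * h) ≤ M.nrm g * M.nrm h :=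
  (le_abs_self _).trans (M.abs_ex_mul_le g h)

theorem nrm_le_of_sq_le {h : Ω → ℝ} {c : ℝ} (hc : 0 ≤ c) (hh : M.ex (h * h) ≤ c ^ 2) :
    M.nrm h ≤ c := by
  rw [← nrm_sq] at hh
  exact (sq_le_sq₀ (M.nrm_nonneg h) hc).1 hh

theorem nrm_add_le (g h : Ω → ℝ) : M.nrm (g + h) ≤ M.nrm g + M.nrm h := by
  apply M.nrm_le_of_sq_le (add_nonneg (M.nrm_nonneg _) (M.nrm_nonneg _))
  have : (g + h) * (g + h) = g * g + (2 : ℝ) • (g * h) + h * h := by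
    ext ω; simp only [Pi.mul_apply, Pi.add_apply, Pi.smul_apply, smul_eq_mul]; ring
  rw [this]
  simp only [map_add, map_smul, smul_eq_mul, ← nrm_sq]
  nlinarith [M.ex_mul_le g h]

theorem nrm_smul (c : ℝ) (h : Ω → ℝ) : M.nrm (c • h) = |c| * M.nrm h := by
  unfold nrm
  have : (c • h) * (c • h) = (c ^ 2) • (h * h) := by
    ext ω; simp only [Pi.mul_apply, Pi.smul_apply, smul_eq_mul]; ring
  rw [this, map_smul, smul_eq_mul, Real.sqrt_mul (sq_nonneg c), Real.sqrt_sq_eq_abs]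

theorem nrm_zero : M.nrm 0 = 0 := by simp [nrm]

theorem nrm_sign_smul (m : ℕ) (h : Ω → ℝ) : M.nrm ((-1 : ℝ) ^ m • h) = M.nrm h := by
  rw [nrm_smul]; simp

theorem nrm_sum_le {ι : Type*} (s : Finset ι) (h : ι → Ω → ℝ) :
    M.nrm (∑ i ∈ s, h i) ≤ ∑ i ∈ s, M.nrm (h i) := by
  classical
  induction s using Finset.induction_on with
  | empty => simp [nrm_zero]
  | insert i s hi ih =>
    rw [sum_insert hi, sum_insert hi]
    exact (M.nrm_add_le _ _).trans (by linarith)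

theorem nrm_sum_le_card_mul {ι : Type*} (s : Finset ι) (h : ι → Ω → ℝ) {c N : ℝ} (hc : 0 ≤ c)
    (hN : (#s : ℝ) ≤ N) (hh : ∀ i ∈ s, M.nrm (h i) ≤ c) : M.nrm (∑ i ∈ s, h i) ≤ N * c := by
  refine (M.nrm_sum_le s h).trans ((sum_le_card_nsmul s _ c hh).trans ?_)
  rw [nsmul_eq_mul]
  exact mul_le_mul_of_nonneg_right hN hc

theorem nrm_mul_le {g h : Ω → ℝ} {c : ℝ} (hc : 0 ≤ c) (hg : ∀ ω, |g ω| ≤ c) :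
    M.nrm (g * h) ≤ c * M.nrm h := by
  apply M.nrm_le_of_sq_le (mul_nonneg hc (M.nrm_nonneg _))
  rw [mul_pow, nrm_sq, ← smul_eq_mul (c ^ 2), ← map_smul]
  refine M.ex_mono fun ω => ?_
  simp only [Pi.mul_apply, Pi.smul_apply, smul_eq_mul]
  have := sq_le_sq' (by linarith [abs_le.1 (hg ω)]) (abs_le.1 (hg ω)).2
  nlinarith [mul_self_nonneg (h ω)]

theorem nrm_cond_le (S : Finset (Fin k)) (h : Ω → ℝ) : M.nrm (M.cond S h) ≤ M.nrm h := by
  have h1 : M.nrm (M.cond S h) ^ 2 ≤ M.nrm h * M.nrm (M.cond S h) := by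
    rw [nrm_sq, ← ex_mul_cond, cond_cond]
    exact M.ex_mul_le _ _
  by_contra hc
  push Not at hc
  nlinarith [M.nrm_nonneg h]

/-- Cauchy–Schwarz for a finite sum of conditional expectations of products. -/
theorem sum_cond_mul_sq_le {ι : Type*} (s : Finset ι) (S : Finset (Fin k)) (g h : ι → Ω → ℝ)
    (ω : Ω) :
    (∑ i ∈ s, M.cond S (g i * h i) ω) ^ 2 ≤
      (∑ i ∈ s, M.cond S (g i * g i) ω) * ∑ i ∈ s, M.cond S (h i * h i) ω := by
  have key := discrim_le_zero (a := ∑ i ∈ s, M.cond S (g i * g i) ω)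
    (b := 2 * ∑ i ∈ s, M.cond S (g i * h i) ω) (c := ∑ i ∈ s, M.cond S (h i * h i) ω) (by
    intro x
    have h0 : 0 ≤ ∑ i ∈ s, M.cond S ((x • g i + h i) * (x • g i + h i)) ω :=
      sum_nonneg fun i _ => M.cond_nonneg S _ (pi_mul_self_nonneg _) ω
    have : ∀ i, (x • g i + h i) * (x • g i + h i) =
        (x * x) • (g i * g i) + (2 * x) • (g i * h i) + h i * h i := by
      intro i
      ext ω; simp only [Pi.mul_apply, Pi.add_apply, Pi.smul_apply, smul_eq_mul]; ring
    simp only [this, map_add, map_smul, Pi.add_apply, Pi.smul_apply, smul_eq_mul,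
      sum_add_distrib, ← mul_sum] at h0
    linarith)
  unfold discrim at key
  nlinarith

/-- `g` depends on the coordinates in `S` only. -/
def Meas (S : Finset (Fin k)) (g : Ω → ℝ) : Prop := M.cond S g = g

variable {M}

theorem Meas.mono {S T : Finset (Fin k)} {g : Ω → ℝ} (hg : M.Meas S g) (h : S ⊆ T) :
    M.Meas T g := by
  unfold Meas at *
  rw [← hg, M.cond_cond_of_superset _ h]

theorem Meas.cond_mul {S : Finset (Fin k)} {g : Ω → ℝ} (hg : M.Meas S g) (h : Ω → ℝ) :
    M.cond S (h * g) = M.cond S h * g := by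
  have := M.cond_mul_cond S h g
  rwa [hg] at this

theorem Meas.mul {S : Finset (Fin k)} {g h : Ω → ℝ} (hg : M.Meas S g) (hh : M.Meas S h) :
    M.Meas S (g * h) := by
  unfold Meas
  rw [hh.cond_mul, hg]

variable (M)

theorem meas_cond (S : Finset (Fin k)) (h : Ω → ℝ) : M.Meas S (M.cond S h) := M.cond_cond S h

/-- Conditional expectations on `S` and `T` compose to the one on `S ∩ T` up to `κ`. -/
def IsApprox (κ : ℝ) : Prop :=
  ∀ S T h, M.nrm (M.cond S (M.cond T h) - M.cond (S ∩ T) h) ≤ κ * M.nrm h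

/-- It suffices to check approximate composition for sets with one private coordinate each. -/
theorem isApprox_of_single {γ : ℝ} (hγ : 0 ≤ γ)
    (H : ∀ (S : Finset (Fin k)) (i j : Fin k), i ∉ S → j ∉ S → i ≠ j → ∀ h,
      M.nrm (M.cond (insert i S) (M.cond (insert j S) h) - M.cond S h) ≤ γ * M.nrm h) :
    M.IsApprox ((k : ℝ) ^ 2 * γ) := by
  have one : ∀ (U : Finset (Fin k)) (b : Fin k), b ∉ U → ∀ A : Finset (Fin k), b ∉ A →
      Disjoint A U → ∀ h, M.nrm (M.cond (U ∪ A) (M.cond (insert b U) h) - M.cond U h) ≤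
        (#A : ℝ) * γ * M.nrm h := by
    intro U b hbU A
    induction A using Finset.induction_on with
    | empty =>
      intro _ _ h
      simp [M.cond_cond_of_subset h (subset_insert b U), nrm_zero]
    | insert a A haA ih =>
      intro hb hd h
      rw [disjoint_insert_left] at hd
      simp only [mem_insert, not_or] at hb
      have h1 := ih hb.2 hd.2 h
      have h2 := H (U ∪ A) a b (by simp [hd.1, haA]) (by simp [hbU, hb.2]) (Ne.symm hb.1)
        (M.cond (insert b U) h)
      rw [M.cond_cond_of_superset h (insert_subset_insert b subset_union_left)] at h2
      have h3 : U ∪ insert a A = insert a (U ∪ A) := by rw [union_insert]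
      rw [h3, card_insert_of_notMem haA]
      have h4 := M.nrm_add_le (M.cond (insert a (U ∪ A)) (M.cond (insert b U) h) -
        M.cond (U ∪ A) (M.cond (insert b U) h))
        (M.cond (U ∪ A) (M.cond (insert b U) h) - M.cond U h)
      rw [sub_add_sub_cancel] at h4
      have h5 := mul_le_mul_of_nonneg_left (M.nrm_cond_le (insert b U) h) hγ
      push_cast
      linarith
  have two : ∀ (U A : Finset (Fin k)), Disjoint A U → ∀ B : Finset (Fin k), Disjoint B U →
      Disjoint A B → ∀ h, M.nrm (M.cond (U ∪ A) (M.cond (U ∪ B) h) - M.cond U h) ≤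
        (#B : ℝ) * (#A * γ) * M.nrm h := by
    intro U A hA B
    induction B using Finset.induction_on with
    | empty =>
      intro _ _ h
      simp [M.cond_cond_of_superset h (subset_union_left (s₁ := U) (s₂ := A)), nrm_zero]
    | insert b B hbB ih =>
      intro hB hAB h
      rw [disjoint_insert_left] at hB
      rw [disjoint_insert_right] at hAB
      have h1 := ih hB.2 hAB.2 h
      have h2 := one (U ∪ B) b (by simp [hB.1, hbB]) A hAB.1
        (disjoint_union_right.2 ⟨hA, hAB.2⟩) h
      have h3 := (M.nrm_cond_le (U ∪ A) _).trans h2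
      rw [map_sub, M.cond_cond_of_subset _ (union_subset_union subset_union_left Subset.rfl)] at h3
      have h4 := M.nrm_add_le (M.cond (U ∪ A) (M.cond (insert b (U ∪ B)) h) -
        M.cond (U ∪ A) (M.cond (U ∪ B) h)) (M.cond (U ∪ A) (M.cond (U ∪ B) h) - M.cond U h)
      rw [sub_add_sub_cancel] at h4
      rw [union_insert, card_insert_of_notMem hbB]
      push_cast
      linarith
  intro S T h
  have h1 := two (S ∩ T) (S \ T) (disjoint_left.2 (by simp; tauto)) (T \ S)
    (disjoint_left.2 (by simp; tauto)) (disjoint_left.2 (by simp; tauto)) h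
  rw [show S ∩ T ∪ S \ T = S by ext; simp; tauto,
    show S ∩ T ∪ T \ S = T by ext; simp; tauto] at h1
  refine h1.trans (mul_le_mul_of_nonneg_right ?_ (M.nrm_nonneg h))
  have c1 : (#(T \ S) : ℝ) ≤ k := by exact_mod_cast (card_le_univ _).trans (by simp)
  have c2 : (#(S \ T) : ℝ) ≤ k := by exact_mod_cast (card_le_univ _).trans (by simp)
  rw [sq, mul_assoc]
  gcongr

end CondSystem

theorem sum_powerset_union_sign {α E : Type*} [DecidableEq α] [AddCommGroup E] [Module ℝ E]
    (e : Finset α → E) {V R : Finset α} (hVR : Disjoint V R) :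
    ∑ T ∈ (V ∪ R).powerset, (-1 : ℝ) ^ #((V ∪ R) \ T) • e T =
      ∑ W ∈ V.powerset, (-1 : ℝ) ^ #(V \ W) •
        ∑ T ∈ R.powerset, (-1 : ℝ) ^ #(R \ T) • e (W ∪ T) := by
  induction V using Finset.induction_on generalizing e with
  | empty => simp
  | insert v V hv ih =>
    rw [disjoint_insert_left] at hVR
    rw [insert_union, sum_powerset_insert_sign e (by simp [hv, hVR.1]),
      ih (fun T => e (insert v T) - e T) hVR.2,
      sum_powerset_insert_sign
        (fun W => ∑ T ∈ R.powerset, (-1 : ℝ) ^ #(R \ T) • e (W ∪ T)) hv]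
    refine sum_congr rfl fun W _ => ?_
    rw [← sum_sub_distrib]
    simp only [smul_sub, insert_union]

namespace CondSystem

variable {Ω : Type*} [Fintype Ω] {k : ℕ} (M : CondSystem Ω k)

/-- The part of a function living exactly on the coordinates `R`, relative to `W`. -/
noncomputable def level (W R : Finset (Fin k)) : (Ω → ℝ) →ₗ[ℝ] (Ω → ℝ) :=
  ∑ T ∈ R.powerset, (-1 : ℝ) ^ #(R \ T) • M.cond (W ∪ T)

theorem level_apply (W R : Finset (Fin k)) (h : Ω → ℝ) :
    M.level W R h = ∑ T ∈ R.powerset, (-1 : ℝ) ^ #(R \ T) • M.cond (W ∪ T) h := by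
  simp [level]

theorem card_powerset_le (R : Finset (Fin k)) : (#R.powerset : ℝ) ≤ 2 ^ k := by
  rw [card_powerset]
  push_cast
  exact pow_le_pow_right₀ (by norm_num) ((card_le_univ R).trans (by simp))

theorem meas_level (W R : Finset (Fin k)) (h : Ω → ℝ) : M.Meas (W ∪ R) (M.level W R h) := by
  unfold Meas
  rw [level_apply, map_sum]
  refine sum_congr rfl fun T hT => ?_
  rw [map_smul, M.cond_cond_of_superset _ (union_subset_union Subset.rfl (mem_powerset.1 hT))]

theorem nrm_level_le (W R : Finset (Fin k)) (h : Ω → ℝ) :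
    M.nrm (M.level W R h) ≤ 2 ^ #R * M.nrm h := by
  rw [level_apply]
  refine M.nrm_sum_le_card_mul _ _ (M.nrm_nonneg h) (by simp) fun T _ => ?_
  rw [nrm_sign_smul]
  exact M.nrm_cond_le _ h

theorem nrm_level_le' (W R : Finset (Fin k)) (h : Ω → ℝ) :
    M.nrm (M.level W R h) ≤ 2 ^ k * M.nrm h := by
  refine (M.nrm_level_le W R h).trans (mul_le_mul_of_nonneg_right ?_ (M.nrm_nonneg h))
  simpa using card_powerset_le R

theorem abs_level_le {W R : Finset (Fin k)} {h : Ω → ℝ} {δ : ℝ} (hδ : 0 ≤ δ)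
    (H : ∀ T ⊆ R, ∀ ω, |M.cond (W ∪ T) h ω| ≤ δ) (ω : Ω) : |M.level W R h ω| ≤ 2 ^ k * δ := by
  rw [level_apply, Finset.sum_apply]
  refine (abs_sum_le_sum_abs _ _).trans ?_
  refine (sum_le_card_nsmul _ _ δ fun T hT => ?_).trans ?_
  · rw [Pi.smul_apply, smul_eq_mul, abs_mul]
    simpa using H T (mem_powerset.1 hT) ω
  · rw [nsmul_eq_mul]
    exact mul_le_mul_of_nonneg_right (card_powerset_le R) hδ

theorem ex_mul_level (W R : Finset (Fin k)) (g h : Ω → ℝ) :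
    M.ex (g * M.level W R h) = M.ex (M.level W R g * h) := by
  rw [level_apply, level_apply, mul_sum, sum_mul, map_sum, map_sum]
  refine sum_congr rfl fun T _ => ?_
  rw [mul_smul_comm, smul_mul_assoc, map_smul, map_smul, ex_mul_cond]

theorem level_mul_of_meas {W : Finset (Fin k)} (R : Finset (Fin k)) {g : Ω → ℝ}
    (hg : M.Meas W g) (h : Ω → ℝ) : M.level W R (h * g) = M.level W R h * g := by
  rw [level_apply, level_apply, sum_mul]
  refine sum_congr rfl fun T _ => ?_
  rw [(hg.mono subset_union_left).cond_mul, smul_mul_assoc]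

theorem sum_level (W : Finset (Fin k)) (h : Ω → ℝ) :
    ∑ R ∈ Wᶜ.powerset, M.level W R h = h := by
  have := sum_powerset_pow_smul_sum_sign 1 (fun T => M.cond (W ∪ T) h) Wᶜ
  simp only [one_pow, one_smul, sub_self, one_mul, ← level_apply] at this
  rw [this, sum_eq_single Wᶜ]
  · simp [union_compl, M.cond_univ]
  · intro T hT hne
    have : #(Wᶜ \ T) ≠ 0 := by
      rw [Ne, card_eq_zero, sdiff_eq_empty_iff_subset]
      exact fun hs => hne (Subset.antisymm (mem_powerset.1 hT) hs)
    simp [zero_pow this]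
  · simp

theorem level_union {V R : Finset (Fin k)} (hVR : Disjoint V R) (h : Ω → ℝ) :
    M.level ∅ (V ∪ R) h = ∑ W ∈ V.powerset, (-1 : ℝ) ^ #(V \ W) • M.level W R h := by
  simp only [level_apply, empty_union]
  exact sum_powerset_union_sign (fun T => M.cond T h) hVR

variable {M} {κ : ℝ}

theorem IsApprox.nrm_cond_level_le (hM : M.IsApprox κ) (hκ : 0 ≤ κ) (W : Finset (Fin k))
    {R Y : Finset (Fin k)} {v : Fin k} (hvR : v ∈ R) (hvY : v ∉ Y) (h : Ω → ℝ) :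
    M.nrm (M.cond Y (M.level W R h)) ≤ 2 ^ k * (κ * M.nrm h) := by
  have h0 := sum_powerset_sign_eq_zero (fun T => M.cond (Y ∩ (W ∪ T)) h) hvR (fun T => by
    simp only [union_insert, inter_insert_of_notMem hvY])
  rw [level_apply, map_sum, ← sub_zero (∑ T ∈ _, _), ← h0, ← sum_sub_distrib]
  refine M.nrm_sum_le_card_mul _ _ (mul_nonneg hκ (M.nrm_nonneg h)) (card_powerset_le R)
    fun T _ => ?_
  rw [map_smul, ← smul_sub, nrm_sign_smul]
  exact hM _ _ h

theorem IsApprox.nrm_level_cond_le (hM : M.IsApprox κ) (hκ : 0 ≤ κ) (W : Finset (Fin k))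
    {R Y : Finset (Fin k)} {v : Fin k} (hvR : v ∈ R) (hvY : v ∉ Y) (h : Ω → ℝ) :
    M.nrm (M.level W R (M.cond Y h)) ≤ 2 ^ k * (κ * M.nrm h) := by
  have h0 := sum_powerset_sign_eq_zero (fun T => M.cond ((W ∪ T) ∩ Y) h) hvR (fun T => by
    simp only [union_insert, insert_inter_of_notMem hvY])
  rw [level_apply, ← sub_zero (∑ T ∈ _, _), ← h0, ← sum_sub_distrib]
  refine M.nrm_sum_le_card_mul _ _ (mul_nonneg hκ (M.nrm_nonneg h)) (card_powerset_le R)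
    fun T _ => ?_
  rw [← smul_sub, nrm_sign_smul]
  exact hM _ _ h

theorem IsApprox.nrm_level_level_sub_le (hM : M.IsApprox κ) (hκ : 0 ≤ κ) {W R : Finset (Fin k)}
    (hRW : Disjoint R W) (h : Ω → ℝ) :
    M.nrm (M.level W R (M.level W R h) - M.level W R h) ≤ 2 ^ k * (2 ^ k * (κ * M.nrm h)) := by
  have h1 : M.level W R (M.level W R h) - M.level W R h =
      ∑ T ∈ R.powerset.erase R, (-1 : ℝ) ^ #(R \ T) • M.cond (W ∪ T) (M.level W R h) := by
    rw [M.level_apply W R (M.level W R h),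
      ← add_sum_erase _ _ (mem_powerset_self R), M.meas_level W R h]
    simp
  have hκ' := mul_nonneg hκ (M.nrm_nonneg h)
  rw [h1]
  refine M.nrm_sum_le_card_mul _ _ (by positivity)
    (le_trans (by exact_mod_cast card_le_card (erase_subset _ _)) (card_powerset_le R))
    fun T hT => ?_
  rw [nrm_sign_smul]
  obtain ⟨hne, hTR⟩ := mem_erase.1 hT
  obtain ⟨v, hvR, hvT⟩ := exists_of_ssubset (ssubset_of_subset_of_ne (mem_powerset.1 hTR) hne)
  exact hM.nrm_cond_level_le hκ W hvR
    (by simp [hvT, disjoint_left.1 hRW hvR]) h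

theorem IsApprox.abs_ex_level_sub_le (hM : M.IsApprox κ) (hκ : 0 ≤ κ) {W R : Finset (Fin k)}
    (hRW : Disjoint R W) (g h : Ω → ℝ) :
    |M.ex (M.level W R g * M.level W R h) - M.ex (g * M.level W R h)| ≤
      2 ^ k * 2 ^ k * κ * (M.nrm g * M.nrm h) := by
  rw [← ex_mul_level, ← map_sub, ← mul_sub]
  refine (M.abs_ex_mul_le _ _).trans ?_
  have := mul_le_mul_of_nonneg_left (hM.nrm_level_level_sub_le hκ hRW h) (M.nrm_nonneg g)
  linarith

/-- Conditioning on `U` decorrelates up to the common coordinates of `U`, `S` and `T`. -/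
theorem IsApprox.ex_cond_mul_cond_le (hM : M.IsApprox κ) {S T : Finset (Fin k)}
    (U : Finset (Fin k)) {g h : Ω → ℝ} (hg : M.Meas S g) (hh : M.Meas T h) :
    M.ex (M.cond U g * M.cond U h) ≤
      M.ex (M.cond (S ∩ (U ∩ T)) g * M.cond (S ∩ (U ∩ T)) h) +
        2 * κ * (M.nrm g * M.nrm h) := by
  have e1 : M.ex (M.cond U g * M.cond U h) = M.ex (g * M.cond U (M.cond T h)) := by
    rw [← ex_mul_cond, cond_cond, hh]
  have e2 : M.ex (g * M.cond (U ∩ T) h) = M.ex (g * M.cond S (M.cond (U ∩ T) h)) := by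
    rw [M.ex_mul_cond S, hg]
  have e3 : M.ex (M.cond (S ∩ (U ∩ T)) g * M.cond (S ∩ (U ∩ T)) h) =
      M.ex (g * M.cond (S ∩ (U ∩ T)) h) := by
    rw [← ex_mul_cond, cond_cond]
  have b1 := M.ex_mul_le g (M.cond U (M.cond T h) - M.cond (U ∩ T) h)
  have b2 := M.ex_mul_le g (M.cond S (M.cond (U ∩ T) h) - M.cond (S ∩ (U ∩ T)) h)
  have b3 := mul_le_mul_of_nonneg_left (hM U T h) (M.nrm_nonneg g)
  have b4 : M.nrm (M.cond S (M.cond (U ∩ T) h) - M.cond (S ∩ (U ∩ T)) h) ≤ κ * M.nrm h := by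
    have := hM S (U ∩ T) h
    exact this
  have b5 := mul_le_mul_of_nonneg_left b4 (M.nrm_nonneg g)
  rw [mul_sub, map_sub] at b1 b2
  rw [e1, e3]
  linarith

end CondSystem

namespace CondSystem

variable {Ω : Type*} [Fintype Ω] {k : ℕ} (M : CondSystem Ω k)

/-- All conditional expectations of `f` on fewer than `r` coordinates are at most `δ`. -/
structure Spread (f : Ω → ℝ) (r : ℕ) (δ : ℝ) : Prop where
  bool : f * f = f
  nonneg : 0 ≤ δ
  le_dim : r ≤ k
  cond_le : ∀ T, #T < r → ∀ ω, M.cond T f ω ≤ δ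

/-- The sets of fewer than `r` coordinates. -/
def small (k r : ℕ) : Finset (Finset (Fin k)) := univ.filter fun S => #S < r

theorem mem_small {r : ℕ} {S : Finset (Fin k)} : S ∈ small k r ↔ #S < r := by simp [small]

theorem card_le_two_pow (s : Finset (Finset (Fin k))) : (#s : ℝ) ≤ 2 ^ k := by
  have := card_le_univ s
  simp only [Fintype.card_finset, Fintype.card_fin] at this
  exact_mod_cast this

/-- The square of the level part of `f` on `S`. -/
noncomputable def sqLevel (f : Ω → ℝ) (S : Finset (Fin k)) : Ω → ℝ :=
  M.level ∅ S f * M.level ∅ S f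

/-- The level-`< r` energy of `f` above `V`, conditioned on the coordinates `V`. -/
noncomputable def energy (f : Ω → ℝ) (r : ℕ) (V : Finset (Fin k)) : Ω → ℝ :=
  ∑ S ∈ (small k r).filter (V ⊆ ·), M.cond V (sqLevel M f S)

variable {M} {f : Ω → ℝ} {r : ℕ} {δ κ : ℝ}

theorem Spread.f_nonneg (hf : M.Spread f r δ) : 0 ≤ f := by
  rw [← hf.bool]; exact pi_mul_self_nonneg f

theorem Spread.ex_eq (hf : M.Spread f r δ) : M.ex f = M.nrm f ^ 2 := by rw [nrm_sq, hf.bool]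

theorem Spread.abs_cond_le (hf : M.Spread f r δ) {T : Finset (Fin k)} (hT : #T < r) (ω : Ω) :
    |M.cond T f ω| ≤ δ := by
  rw [abs_of_nonneg (M.cond_nonneg T f hf.f_nonneg ω)]
  exact hf.cond_le T hT ω

theorem Spread.abs_level_le (hf : M.Spread f r δ) {W R : Finset (Fin k)} (h : #(W ∪ R) < r)
    (ω : Ω) : |M.level W R f ω| ≤ 2 ^ k * δ :=
  M.abs_level_le hf.nonneg (fun _ hT ω => hf.abs_cond_le
    ((card_le_card (union_subset_union Subset.rfl hT)).trans_lt h) ω) ω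

theorem Spread.abs_level_empty_le (hf : M.Spread f r δ) {S : Finset (Fin k)} (h : #S < r)
    (ω : Ω) : |M.level ∅ S f ω| ≤ 2 ^ k * δ := hf.abs_level_le (by simpa using h) ω

theorem Spread.nrm_level_mul_level_le (hf : M.Spread f r δ) {W R W' R' : Finset (Fin k)}
    (h : #(W ∪ R) < r) :
    M.nrm (M.level W R f * M.level W' R' f) ≤ 2 ^ k * δ * (2 ^ k * M.nrm f) := by
  have hδ := hf.nonneg
  exact (M.nrm_mul_le (by positivity) (hf.abs_level_le h)).trans
    (mul_le_mul_of_nonneg_left (M.nrm_level_le' _ _ _) (by positivity))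

theorem Spread.nrm_sqLevel_le (hf : M.Spread f r δ) {S : Finset (Fin k)} (h : #S < r) :
    M.nrm (M.sqLevel f S) ≤ 2 ^ k * δ * (2 ^ k * M.nrm f) :=
  hf.nrm_level_mul_level_le (by simpa using h)

theorem sqLevel_nonneg (S : Finset (Fin k)) : 0 ≤ M.sqLevel f S := pi_mul_self_nonneg _

theorem meas_sqLevel (S : Finset (Fin k)) : M.Meas S (M.sqLevel f S) := by
  have := M.meas_level ∅ S f
  rw [empty_union] at this
  exact this.mul this

theorem energy_nonneg (V : Finset (Fin k)) : 0 ≤ M.energy f r V :=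
  sum_nonneg fun S _ => M.cond_nonneg V _ (sqLevel_nonneg S)

theorem meas_energy (V : Finset (Fin k)) : M.Meas V (M.energy f r V) := by
  unfold Meas energy
  rw [map_sum]
  exact sum_congr rfl fun S _ => M.cond_cond V _

theorem Spread.energy_le (hf : M.Spread f r δ) (V : Finset (Fin k)) (ω : Ω) :
    M.energy f r V ω ≤ 2 ^ k * (2 ^ k * δ) ^ 2 := by
  rw [energy, Finset.sum_apply]
  have hδ := hf.nonneg
  refine (sum_le_card_nsmul _ _ ((2 ^ k * δ) ^ 2) fun S hS => ?_).trans ?_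
  · refine M.cond_le_const V (fun ω => ?_) ω
    have := hf.abs_level_empty_le (mem_small.1 (mem_filter.1 hS).1) ω
    rw [sqLevel, Pi.mul_apply, ← sq]
    exact sq_le_sq' (by linarith [abs_le.1 this]) (abs_le.1 this).2
  · rw [nsmul_eq_mul]
    exact mul_le_mul_of_nonneg_right (card_le_two_pow _) (by positivity)

theorem Spread.nrm_energy_le (hf : M.Spread f r δ) (V : Finset (Fin k)) :
    M.nrm (M.energy f r V) ≤ 2 ^ k * (2 ^ k * δ * (2 ^ k * M.nrm f)) := by
  have hδ := hf.nonneg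
  have := M.nrm_nonneg f
  refine M.nrm_sum_le_card_mul _ _ (by positivity) (card_le_two_pow _) fun S hS => ?_
  exact (M.nrm_cond_le V _).trans (hf.nrm_sqLevel_le (mem_small.1 (mem_filter.1 hS).1))

/-- Approximate Parseval relative to `W`, against a nonnegative weight depending on `W` only. -/
theorem Spread.sum_ex_weight_le (hf : M.Spread f r δ) (hM : M.IsApprox κ) (hκ : 0 ≤ κ)
    {W : Finset (Fin k)} (hW : #W < r) {ψ : Ω → ℝ} (hψ : M.Meas W ψ) (hψ0 : 0 ≤ ψ) {c : ℝ}
    (hc : 0 ≤ c) (hψc : ∀ ω, ψ ω ≤ c) :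
    ∑ R ∈ Wᶜ.powerset, M.ex (ψ * (M.level W R f * M.level W R f)) ≤
      δ * M.ex ψ + 2 ^ k * (2 ^ k * 2 ^ k * κ * (c * M.nrm f * M.nrm f)) := by
  have hn := M.nrm_nonneg f
  have hterm : ∀ R ∈ Wᶜ.powerset, M.ex (ψ * (M.level W R f * M.level W R f)) ≤
      M.ex (f * ψ * M.level W R f) + 2 ^ k * 2 ^ k * κ * (c * M.nrm f * M.nrm f) := by
    intro R hR
    have hRW : Disjoint R W := by
      rw [← le_compl_iff_disjoint_right]; exact mem_powerset.1 hR
    have h1 := (abs_le.1 (hM.abs_ex_level_sub_le hκ hRW (f * ψ) f)).2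
    rw [M.level_mul_of_meas R hψ f] at h1
    have h2 : M.nrm (f * ψ) ≤ c * M.nrm f := by
      rw [mul_comm f ψ]
      exact M.nrm_mul_le hc fun ω => by rw [abs_of_nonneg (hψ0 ω)]; exact hψc ω
    have h3 : 2 ^ k * 2 ^ k * κ * (M.nrm (f * ψ) * M.nrm f) ≤
        2 ^ k * 2 ^ k * κ * (c * M.nrm f * M.nrm f) := by gcongr
    have h4 : ψ * (M.level W R f * M.level W R f) = M.level W R f * ψ * M.level W R f := by ring
    rw [h4]
    linarith
  refine (sum_le_sum hterm).trans ?_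
  rw [sum_add_distrib, ← map_sum, ← mul_sum, sum_level, sum_const, nsmul_eq_mul]
  refine add_le_add ?_ (mul_le_mul_of_nonneg_right (card_powerset_le _) (by positivity))
  have h5 : f * ψ * f = f * M.cond W ψ := by
    rw [hψ, mul_right_comm, hf.bool]
  rw [h5, ex_mul_cond, ← smul_eq_mul δ, ← map_smul]
  refine M.ex_mono fun ω => ?_
  simpa using mul_le_mul_of_nonneg_right (hf.cond_le W hW ω) (hψ0 ω)

theorem Spread.ex_energy_sq_le (hf : M.Spread f r δ) (hM : M.IsApprox κ) (hκ : 0 ≤ κ)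
    (V : Finset (Fin k)) :
    M.ex (M.energy f r V * M.energy f r V) ≤ 4 ^ r * (δ * M.ex (M.energy f r V) +
      2 * (2 ^ k) ^ 6 * κ * δ ^ 2 * M.nrm f ^ 2) := by
  have hδ := hf.nonneg
  have hn := M.nrm_nonneg f
  have hG0 := energy_nonneg (M := M) (f := f) (r := r) V
  have hE := M.ex_nonneg hG0
  rcases lt_or_ge (#V) r with hV | hV
  swap
  · have h0 : M.energy f r V = 0 := by
      refine sum_eq_zero fun S hS => ?_
      simp only [mem_filter, mem_small] at hS
      exact absurd (card_le_card hS.2) (by omega)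
    simp only [h0, map_zero, mul_zero]
    positivity
  set G := M.energy f r V with hG
  set 𝓢 := (small k r).filter (V ⊆ ·) with h𝓢
  have e1 : M.ex (G * G) = ∑ S ∈ 𝓢, M.ex (G * M.sqLevel f S) := by
    conv_lhs => rw [hG]
    rw [show M.energy f r V * M.energy f r V = G * ∑ S ∈ 𝓢, M.cond V (M.sqLevel f S) from rfl,
      mul_sum, map_sum]
    refine sum_congr rfl fun S _ => ?_
    rw [ex_mul_cond, show M.cond V G = G from meas_energy V]
  have e2 : ∀ S ∈ 𝓢, M.ex (G * M.sqLevel f S) ≤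
      2 ^ r * ∑ W ∈ V.powerset, M.ex (G * (M.level W (S \ V) f * M.level W (S \ V) f)) := by
    intro S hS
    have hVS : V ⊆ S := (mem_filter.1 hS).2
    rw [← map_sum, ← mul_sum, ← smul_eq_mul ((2 : ℝ) ^ r), ← map_smul]
    refine M.ex_mono fun ω => ?_
    have h1 := M.level_union (disjoint_sdiff (s := V) (t := S)) f
    rw [union_sdiff_of_subset hVS] at h1
    have h2 := sq_sum_le_card_mul_sum_sq (s := V.powerset)
      (f := fun W => ((-1 : ℝ) ^ #(V \ W) • M.level W (S \ V) f) ω)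
    simp only [Pi.mul_apply, Pi.smul_apply, smul_eq_mul, sqLevel, h1, Finset.sum_apply] at h2 ⊢
    have h3 : ∀ W, ((-1 : ℝ) ^ #(V \ W) * M.level W (S \ V) f ω) ^ 2 =
        M.level W (S \ V) f ω * M.level W (S \ V) f ω := by
      intro W
      rw [mul_pow, ← pow_mul, mul_comm (#_), pow_mul]; norm_num; ring
    simp only [h3] at h2
    have h4 : (#V.powerset : ℝ) ≤ 2 ^ r := by
      rw [card_powerset]; push_cast
      exact pow_le_pow_right₀ (by norm_num) hV.le
    have h5 : 0 ≤ ∑ W ∈ V.powerset, M.level W (S \ V) f ω * M.level W (S \ V) f ω :=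
      sum_nonneg fun W _ => mul_self_nonneg _
    have h6 := mul_le_mul_of_nonneg_right h4 h5
    have h7 := mul_le_mul_of_nonneg_left (h2.trans h6) (hG0 ω)
    calc _ = G ω * (∑ W ∈ V.powerset, (-1 : ℝ) ^ #(V \ W) * M.level W (S \ V) f ω) ^ 2 := by ring
      _ ≤ _ := h7
      _ = _ := by ring
  have e3 : ∀ W ∈ V.powerset, ∑ S ∈ 𝓢, M.ex (G * (M.level W (S \ V) f * M.level W (S \ V) f)) ≤
      δ * M.ex G + 2 * (2 ^ k) ^ 6 * κ * δ ^ 2 * M.nrm f ^ 2 := by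
    intro W hW
    have hWV := mem_powerset.1 hW
    have a1 : ∀ S ∈ 𝓢, M.ex (G * (M.level W (S \ V) f * M.level W (S \ V) f)) ≤
        M.ex (M.cond W G * (M.level W (S \ V) f * M.level W (S \ V) f)) +
        κ * ((2 ^ k * (2 ^ k * δ * (2 ^ k * M.nrm f))) * (2 ^ k * δ * (2 ^ k * M.nrm f))) := by
      intro S hS
      obtain ⟨hSr, hVS⟩ := mem_filter.1 hS
      have hcard : #(W ∪ S \ V) < r :=
        (card_le_card (union_subset (hWV.trans hVS) sdiff_subset)).trans_lt (mem_small.1 hSr)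
      set p := M.level W (S \ V) f * M.level W (S \ V) f with hp
      have hpm : M.Meas (W ∪ S \ V) p := (M.meas_level _ _ f).mul (M.meas_level _ _ f)
      have b1 : M.ex (G * p) = M.ex (G * M.cond V (M.cond (W ∪ S \ V) p)) := by
        rw [ex_mul_cond, show M.cond V G = G from meas_energy V, hpm]
      have b2 : V ∩ (W ∪ S \ V) = W := by
        ext a; simp only [mem_inter, mem_union, mem_sdiff]
        constructor
        · tauto
        · exact fun h => ⟨hWV h, Or.inl h⟩
      have b3 := hM V (W ∪ S \ V) p
      rw [b2] at b3
      have b4 := M.ex_mul_le G (M.cond V (M.cond (W ∪ S \ V) p) - M.cond W p)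
      have b5 : M.nrm G * M.nrm (M.cond V (M.cond (W ∪ S \ V) p) - M.cond W p) ≤
          (2 ^ k * (2 ^ k * δ * (2 ^ k * M.nrm f))) * (κ * (2 ^ k * δ * (2 ^ k * M.nrm f))) :=
        mul_le_mul (hf.nrm_energy_le V)
          (b3.trans (mul_le_mul_of_nonneg_left (hf.nrm_level_mul_level_le hcard) hκ))
          (M.nrm_nonneg _) (by positivity)
      rw [mul_sub, map_sub, M.ex_mul_cond W] at b4
      linarith
    have a2 := hf.sum_ex_weight_le hM hκ ((card_le_card hWV).trans_lt hV) (M.meas_cond W G)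
      (M.cond_nonneg W G hG0) (c := 2 ^ k * (2 ^ k * δ) ^ 2) (by positivity)
      (M.cond_le_const W (hf.energy_le V))
    rw [ex_cond] at a2
    have a3 : ∑ S ∈ 𝓢, M.ex (M.cond W G * (M.level W (S \ V) f * M.level W (S \ V) f)) ≤
        ∑ R ∈ Wᶜ.powerset, M.ex (M.cond W G * (M.level W R f * M.level W R f)) := by
      have hinj : Set.InjOn (fun S => S \ V) (𝓢 : Set (Finset (Fin k))) := by
        intro S hS T hT hST
        have h1 := (mem_filter.1 (mem_coe.1 hS)).2
        have h2 := (mem_filter.1 (mem_coe.1 hT)).2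
        have : S \ V = T \ V := hST
        rw [← union_sdiff_of_subset h1, ← union_sdiff_of_subset h2, this]
      rw [← sum_image (f := fun R => M.ex (M.cond W G * (M.level W R f * M.level W R f))) hinj]
      refine sum_le_sum_of_subset_of_nonneg ?_ fun R _ _ =>
        M.ex_nonneg (mul_nonneg (M.cond_nonneg W G hG0) (pi_mul_self_nonneg _))
      intro R hR
      obtain ⟨S, _, rfl⟩ := mem_image.1 hR
      rw [mem_powerset, subset_compl_iff_disjoint_right]
      exact disjoint_of_subset_right hWV sdiff_disjoint
    have a4 := sum_le_sum a1
    rw [sum_add_distrib, sum_const, nsmul_eq_mul] at a4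
    have a5 : (#𝓢 : ℝ) * (κ * ((2 ^ k * (2 ^ k * δ * (2 ^ k * M.nrm f))) *
        (2 ^ k * δ * (2 ^ k * M.nrm f)))) ≤ 2 ^ k * (κ * ((2 ^ k * (2 ^ k * δ *
        (2 ^ k * M.nrm f))) * (2 ^ k * δ * (2 ^ k * M.nrm f)))) :=
      mul_le_mul_of_nonneg_right (card_le_two_pow _) (by positivity)
    linarith
  rw [e1]
  refine (sum_le_sum e2).trans ?_
  rw [← mul_sum, sum_comm]
  have e4 := sum_le_sum e3
  rw [sum_const, nsmul_eq_mul, card_powerset] at e4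
  have e5 : ((2 ^ #V : ℕ) : ℝ) ≤ 2 ^ r := by
    push_cast; exact pow_le_pow_right₀ (by norm_num) hV.le
  have e6 : (4 : ℝ) ^ r = 2 ^ r * 2 ^ r := by rw [← mul_pow]; norm_num
  rw [e6, mul_assoc]
  refine mul_le_mul_of_nonneg_left (e4.trans ?_) (by positivity)
  exact mul_le_mul_of_nonneg_right e5 (by positivity)

end CondSystem

namespace CondSystem

variable {Ω : Type*} [Fintype Ω] {k : ℕ} (M : CondSystem Ω k)

/-- The part of `f` on levels below `r`. -/
noncomputable def lowPart (f : Ω → ℝ) (r : ℕ) : Ω → ℝ := ∑ S ∈ small k r, M.level ∅ S f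

/-- The pairs of small sets whose product of level parts contributes to the level `U`. -/
def goodPairs (k r : ℕ) (U : Finset (Fin k)) : Finset (Finset (Fin k) × Finset (Fin k)) :=
  (small k r ×ˢ small k r).filter fun p => p.1 \ p.2 ⊆ U ∧ p.2 \ p.1 ⊆ U ∧ U ⊆ p.1 ∪ p.2

variable {M} {f : Ω → ℝ} {r : ℕ} {δ κ : ℝ}

theorem meas_level_empty (S : Finset (Fin k)) (h : Ω → ℝ) : M.Meas S (M.level ∅ S h) := by
  have := M.meas_level ∅ S h
  rwa [empty_union] at this

theorem level_empty_cond (U : Finset (Fin k)) (h : Ω → ℝ) :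
    M.level ∅ U (M.cond U h) = M.level ∅ U h := by
  simp only [level_apply, empty_union]
  exact sum_congr rfl fun T hT => by rw [M.cond_cond_of_subset _ (mem_powerset.1 hT)]

theorem Spread.nrm_level_mul_le_of_mem (hf : M.Spread f r δ) (hM : M.IsApprox κ) (hκ : 0 ≤ κ)
    {S T : Finset (Fin k)} (hT : #T < r) {U : Finset (Fin k)} {v : Fin k} (hvS : v ∈ S)
    (hvT : v ∉ T) (hvU : v ∉ U) :
    M.nrm (M.level ∅ U (M.level ∅ S f * M.level ∅ T f)) ≤
      (2 ^ k) ^ 3 * κ * δ * M.nrm f := by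
  have hδ := hf.nonneg
  have hn := M.nrm_nonneg f
  have key : ∀ W ∈ U.powerset, M.nrm ((-1 : ℝ) ^ #(U \ W) •
      M.cond (∅ ∪ W) (M.level ∅ S f * M.level ∅ T f)) ≤
      2 ^ k * δ * (2 ^ k * (κ * M.nrm f)) := by
    intro W hW
    have hvW : v ∉ W ∪ T := by
      rw [mem_union, not_or]; exact ⟨fun h => hvU (mem_powerset.1 hW h), hvT⟩
    rw [nrm_sign_smul, empty_union,
      ← M.cond_cond_of_subset _ (subset_union_left (s₁ := W) (s₂ := T)),
      ((meas_level_empty T f).mono subset_union_right).cond_mul, mul_comm (M.cond _ _)]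
    refine (M.nrm_cond_le _ _).trans ((M.nrm_mul_le (by positivity)
      (hf.abs_level_empty_le hT)).trans ?_)
    exact mul_le_mul_of_nonneg_left (hM.nrm_cond_level_le hκ ∅ hvS hvW f) (by positivity)
  rw [level_apply M ∅ U]
  refine (M.nrm_sum_le_card_mul _ _ (by positivity) (card_powerset_le U) key).trans (le_of_eq ?_)
  ring

theorem Spread.nrm_level_mul_le_of_notMem_goodPairs (hf : M.Spread f r δ) (hM : M.IsApprox κ)
    (hκ : 0 ≤ κ) {S T : Finset (Fin k)} (hS : #S < r) (hT : #T < r) {U : Finset (Fin k)}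
    (h : ¬ (S \ T ⊆ U ∧ T \ S ⊆ U ∧ U ⊆ S ∪ T)) :
    M.nrm (M.level ∅ U (M.level ∅ S f * M.level ∅ T f)) ≤
      (2 ^ k) ^ 3 * κ * δ * M.nrm f := by
  by_cases h1 : S \ T ⊆ U
  · by_cases h2 : T \ S ⊆ U
    · obtain ⟨v, hvU, hv⟩ := not_subset.1 (fun h3 => h ⟨h1, h2, h3⟩ : ¬ U ⊆ S ∪ T)
      have hm : M.Meas (S ∪ T) (M.level ∅ S f * M.level ∅ T f) :=
        ((meas_level_empty S f).mono subset_union_left).mul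
          ((meas_level_empty T f).mono subset_union_right)
      rw [← hm]
      refine (hM.nrm_level_cond_le hκ ∅ hvU hv _).trans ?_
      have := hf.nrm_level_mul_level_le (W := ∅) (R := S) (W' := ∅) (R' := T) (by simpa using hS)
      calc _ ≤ 2 ^ k * (κ * (2 ^ k * δ * (2 ^ k * M.nrm f))) := by gcongr
        _ = _ := by ring
    · obtain ⟨v, hv, hvU⟩ := not_subset.1 h2
      rw [mem_sdiff] at hv
      rw [mul_comm (M.level ∅ S f)]
      exact hf.nrm_level_mul_le_of_mem hM hκ hS hv.1 hv.2 hvU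
  · obtain ⟨v, hv, hvU⟩ := not_subset.1 h1
    rw [mem_sdiff] at hv
    exact hf.nrm_level_mul_le_of_mem hM hκ hT hv.1 hv.2 hvU

theorem Spread.nrm_level_lowPart_sq_le (hf : M.Spread f r δ) (hM : M.IsApprox κ) (hκ : 0 ≤ κ)
    (U : Finset (Fin k)) :
    M.nrm (M.level ∅ U (M.lowPart f r * M.lowPart f r)) ≤
      M.nrm (M.level ∅ U (∑ p ∈ goodPairs k r U, M.level ∅ p.1 f * M.level ∅ p.2 f)) +
        (2 ^ k) ^ 5 * κ * δ * M.nrm f := by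
  have hδ := hf.nonneg
  have hn := M.nrm_nonneg f
  rw [lowPart, sum_mul_sum, ← sum_product', ← sum_filter_add_sum_filter_not _
    (fun p : Finset (Fin k) × Finset (Fin k) => p.1 \ p.2 ⊆ U ∧ p.2 \ p.1 ⊆ U ∧ U ⊆ p.1 ∪ p.2),
    map_add]
  refine (M.nrm_add_le _ _).trans (add_le_add le_rfl ?_)
  rw [map_sum]
  refine (M.nrm_sum_le_card_mul _ _ (c := (2 ^ k) ^ 3 * κ * δ * M.nrm f) (N := (2 ^ k) ^ 2)
    (by positivity) ?_ ?_).trans (le_of_eq (by ring))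
  · refine (Nat.cast_le.2 (card_filter_le _ _)).trans ?_
    rw [card_product, Nat.cast_mul, sq]
    exact mul_le_mul (card_le_two_pow _) (card_le_two_pow _) (by positivity) (by positivity)
  · intro p hp
    rw [mem_filter, mem_product, mem_small, mem_small] at hp
    exact hf.nrm_level_mul_le_of_notMem_goodPairs hM hκ hp.1.1 hp.1.2 hp.2

theorem sq_cond_sum_goodPairs_le (U : Finset (Fin k)) (hU : #U ≤ 2 * r) (ω : Ω) :
    (M.cond U (∑ p ∈ goodPairs k r U, M.level ∅ p.1 f * M.level ∅ p.2 f) ω) ^ 2 ≤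
      16 ^ r * ∑ p ∈ (small k r ×ˢ small k r).filter (fun p => U ⊆ p.1 ∪ p.2),
        M.cond U (M.sqLevel f p.1) ω * M.cond U (M.sqLevel f p.2) ω := by
  set φ : Finset (Fin k) × Finset (Fin k) → Finset (Fin k) × Finset (Fin k) :=
    fun p => (p.1 ∩ U, p.2 ∩ U) with hφ
  set Qs := (U.powerset ×ˢ U.powerset).filter (fun q => U ⊆ q.1 ∪ q.2) with hQs
  have hmaps : ∀ p : Finset (Fin k) × Finset (Fin k), U ⊆ p.1 ∪ p.2 → φ p ∈ Qs := by
    intro p hp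
    simp only [hφ, hQs, mem_filter, mem_product, mem_powerset, inter_subset_right, and_self,
      true_and]
    intro a ha
    have := hp ha
    simp only [mem_union, mem_inter] at this ⊢
    tauto
  have hnn : ∀ S, 0 ≤ M.cond U (M.sqLevel f S) ω := fun S => M.cond_nonneg U _ (sqLevel_nonneg S) ω
  rw [map_sum, Finset.sum_apply,
    ← sum_fiberwise_of_maps_to (s := goodPairs k r U) (g := φ) (t := Qs)
      (fun p hp => hmaps p (mem_filter.1 hp).2.2.2),
    ← sum_fiberwise_of_maps_to
      (s := (small k r ×ˢ small k r).filter (fun p => U ⊆ p.1 ∪ p.2)) (g := φ) (t := Qs)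
      (fun p hp => hmaps p (mem_filter.1 hp).2)]
  have hcard : (#Qs : ℝ) ≤ 16 ^ r := by
    refine (Nat.cast_le.2 (card_filter_le _ _)).trans ?_
    rw [card_product, card_powerset, ← mul_pow]
    push_cast
    calc (4 : ℝ) ^ #U ≤ 4 ^ (2 * r) := pow_le_pow_right₀ (by norm_num) hU
      _ = 16 ^ r := by rw [pow_mul]; norm_num
  refine sq_sum_le_card_mul_sum_sq.trans ?_
  have hfib : ∀ q ∈ Qs, (∑ p ∈ (goodPairs k r U).filter (φ · = q),
      M.cond U (M.level ∅ p.1 f * M.level ∅ p.2 f) ω) ^ 2 ≤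
      ∑ p ∈ ((small k r ×ˢ small k r).filter (fun p => U ⊆ p.1 ∪ p.2)).filter (φ · = q),
        M.cond U (M.sqLevel f p.1) ω * M.cond U (M.sqLevel f p.2) ω := by
    intro q hq
    have hset : ((small k r ×ˢ small k r).filter (fun p => U ⊆ p.1 ∪ p.2)).filter (φ · = q) =
        (small k r).filter (· ∩ U = q.1) ×ˢ (small k r).filter (· ∩ U = q.2) := by
      ext p
      simp only [hφ, mem_filter, mem_product, Prod.ext_iff]
      constructor
      · tauto
      · rintro ⟨⟨h1, h2⟩, h3, h4⟩
        refine ⟨⟨⟨h1, h3⟩, ?_⟩, h2, h4⟩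
        have h5 : U ⊆ q.1 ∪ q.2 := (mem_filter.1 hq).2
        rw [← h2, ← h4] at h5
        exact h5.trans (union_subset_union inter_subset_left inter_subset_left)
    rw [hset, sum_product' (f := fun S T => M.cond U (M.sqLevel f S) ω * M.cond U (M.sqLevel f T) ω),
      ← sum_mul_sum]
    refine (M.sum_cond_mul_sq_le _ U _ _ ω).trans ?_
    have hsd : ∀ p ∈ (goodPairs k r U).filter (φ · = q), p.1 \ U = p.2 \ U := by
      intro p hp
      obtain ⟨h1, h2, -⟩ := (mem_filter.1 (mem_filter.1 hp).1).2
      ext a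
      have e1 := @h1 a
      have e2 := @h2 a
      simp only [mem_sdiff] at e1 e2 ⊢
      tauto
    have hfst : ∀ p ∈ (goodPairs k r U).filter (φ · = q), p.1 ∩ U = q.1 ∧ p.2 ∩ U = q.2 :=
      fun p hp => Prod.ext_iff.1 (mem_filter.1 hp).2
    have hrec : ∀ A : Finset (Fin k), A = A ∩ U ∪ A \ U := fun A => by
      rw [union_comm, sdiff_union_inter]
    refine mul_le_mul ?_ ?_ (sum_nonneg fun p _ => hnn p.2) (sum_nonneg fun S _ => hnn S)
    · have hinj : Set.InjOn Prod.fst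
          (↑((goodPairs k r U).filter (φ · = q)) : Set (Finset (Fin k) × Finset (Fin k))) := by
        intro p hp p' hp' h
        refine Prod.ext h ?_
        rw [hrec p.2, hrec p'.2, (hfst p hp).2, (hfst p' hp').2, ← hsd p hp, ← hsd p' hp', h]
      refine (sum_image (f := fun S => M.cond U (M.sqLevel f S) ω) hinj).symm.le.trans ?_
      refine sum_le_sum_of_subset_of_nonneg ?_ fun S _ _ => hnn S
      intro S hS
      obtain ⟨p, hp, rfl⟩ := mem_image.1 hS
      exact mem_filter.2 ⟨(mem_product.1 (mem_filter.1 (mem_filter.1 hp).1).1).1, (hfst p hp).1⟩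
    · have hinj : Set.InjOn Prod.snd
          (↑((goodPairs k r U).filter (φ · = q)) : Set (Finset (Fin k) × Finset (Fin k))) := by
        intro p hp p' hp' h
        refine Prod.ext ?_ h
        rw [hrec p.1, hrec p'.1, (hfst p hp).1, (hfst p' hp').1, hsd p hp, hsd p' hp', h]
      refine (sum_image (f := fun S => M.cond U (M.sqLevel f S) ω) hinj).symm.le.trans ?_
      refine sum_le_sum_of_subset_of_nonneg ?_ fun S _ _ => hnn S
      intro S hS
      obtain ⟨p, hp, rfl⟩ := mem_image.1 hS
      exact mem_filter.2 ⟨(mem_product.1 (mem_filter.1 (mem_filter.1 hp).1).1).2, (hfst p hp).2⟩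
  have hnn' : 0 ≤ ∑ q ∈ Qs, (∑ p ∈ (goodPairs k r U).filter (φ · = q),
      M.cond U (M.level ∅ p.1 f * M.level ∅ p.2 f) ω) ^ 2 := sum_nonneg fun _ _ => sq_nonneg _
  exact (mul_le_mul_of_nonneg_right hcard hnn').trans
    (mul_le_mul_of_nonneg_left (sum_le_sum hfib) (by positivity))

theorem nrm_level_goodPairs_sq_le (U : Finset (Fin k)) :
    M.nrm (M.level ∅ U (∑ p ∈ goodPairs k r U, M.level ∅ p.1 f * M.level ∅ p.2 f)) ^ 2 ≤
      256 ^ r * ∑ p ∈ (small k r ×ˢ small k r).filter (fun p => U ⊆ p.1 ∪ p.2),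
        M.ex (M.cond U (M.sqLevel f p.1) * M.cond U (M.sqLevel f p.2)) := by
  have hnn : 0 ≤ ∑ p ∈ (small k r ×ˢ small k r).filter (fun p => U ⊆ p.1 ∪ p.2),
      M.ex (M.cond U (M.sqLevel f p.1) * M.cond U (M.sqLevel f p.2)) :=
    sum_nonneg fun p _ => M.ex_nonneg (mul_nonneg (M.cond_nonneg U _ (sqLevel_nonneg _))
      (M.cond_nonneg U _ (sqLevel_nonneg _)))
  rcases (goodPairs k r U).eq_empty_or_nonempty with h | ⟨p, hp⟩
  · rw [h, sum_empty, map_zero, nrm_zero, zero_pow two_ne_zero]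
    exact mul_nonneg (by positivity) hnn
  have hU : #U ≤ 2 * r := by
    simp only [goodPairs, mem_filter, mem_product, mem_small] at hp
    have h1 := card_le_card hp.2.2.2
    have h2 := card_union_le p.1 p.2
    omega
  set Z := ∑ p ∈ goodPairs k r U, M.level ∅ p.1 f * M.level ∅ p.2 f with hZ
  rw [← level_empty_cond]
  have h1 := M.nrm_level_le ∅ U (M.cond U Z)
  have h2 : M.ex (M.cond U Z * M.cond U Z) ≤
      16 ^ r * ∑ p ∈ (small k r ×ˢ small k r).filter (fun p => U ⊆ p.1 ∪ p.2),
        M.ex (M.cond U (M.sqLevel f p.1) * M.cond U (M.sqLevel f p.2)) := by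
    rw [← map_sum, ← smul_eq_mul ((16 : ℝ) ^ r), ← map_smul]
    refine M.ex_mono fun ω => ?_
    have := sq_cond_sum_goodPairs_le (M := M) (f := f) U hU ω
    simpa only [Pi.mul_apply, Pi.smul_apply, smul_eq_mul, Finset.sum_apply, ← sq] using this
  have h3 : (2 : ℝ) ^ #U ≤ 4 ^ r := by
    calc (2 : ℝ) ^ #U ≤ 2 ^ (2 * r) := pow_le_pow_right₀ (by norm_num) hU
      _ = 4 ^ r := by rw [pow_mul]; norm_num
  calc _ ≤ (4 ^ r * M.nrm (M.cond U Z)) ^ 2 :=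
        pow_le_pow_left₀ (M.nrm_nonneg _)
          (h1.trans (mul_le_mul_of_nonneg_right h3 (M.nrm_nonneg _))) 2
    _ = 16 ^ r * M.ex (M.cond U Z * M.cond U Z) := by
        rw [mul_pow, nrm_sq, ← pow_mul, mul_comm r 2, pow_mul]; norm_num
    _ ≤ 16 ^ r * (16 ^ r * _) := mul_le_mul_of_nonneg_left h2 (by positivity)
    _ = _ := by rw [← mul_assoc, ← mul_pow]; norm_num

theorem ex_energy_sq_eq (V : Finset (Fin k)) :
    M.ex (M.energy f r V * M.energy f r V) =
      ∑ p ∈ (small k r ×ˢ small k r).filter (fun p => V ⊆ p.1 ∩ p.2),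
        M.ex (M.cond V (M.sqLevel f p.1) * M.cond V (M.sqLevel f p.2)) := by
  have : (small k r ×ˢ small k r).filter (fun p => V ⊆ p.1 ∩ p.2) =
      (small k r).filter (V ⊆ ·) ×ˢ (small k r).filter (V ⊆ ·) := by
    ext p; simp only [mem_filter, mem_product, subset_inter_iff]; tauto
  rw [this, energy, sum_mul_sum, ← sum_product', map_sum]

/-- Summing over the conditioning set, the pair correlations reduce to the energies. -/
theorem Spread.sum_ex_cond_sqLevel_le (hf : M.Spread f r δ) (hM : M.IsApprox κ) (hκ : 0 ≤ κ) :
    ∑ U : Finset (Fin k), ∑ p ∈ (small k r ×ˢ small k r).filter (fun p => U ⊆ p.1 ∪ p.2),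
        M.ex (M.cond U (M.sqLevel f p.1) * M.cond U (M.sqLevel f p.2)) ≤
      4 ^ r * ∑ V : Finset (Fin k), M.ex (M.energy f r V * M.energy f r V) +
        2 * (2 ^ k) ^ 7 * κ * δ ^ 2 * M.nrm f ^ 2 := by
  have hδ := hf.nonneg
  have hn := M.nrm_nonneg f
  set h : Finset (Fin k) × Finset (Fin k) → Finset (Fin k) → ℝ := fun p V =>
    M.ex (M.cond V (M.sqLevel f p.1) * M.cond V (M.sqLevel f p.2)) with hh
  have hnn : ∀ p V, 0 ≤ h p V := fun p V =>
    M.ex_nonneg (mul_nonneg (M.cond_nonneg V _ (sqLevel_nonneg _))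
      (M.cond_nonneg V _ (sqLevel_nonneg _)))
  set c := 2 * κ * ((2 ^ k * δ * (2 ^ k * M.nrm f)) * (2 ^ k * δ * (2 ^ k * M.nrm f))) with hc
  have hc0 : 0 ≤ c := by positivity
  have hpair : ∀ p ∈ small k r ×ˢ small k r,
      ∑ U ∈ univ.filter (fun U => U ⊆ p.1 ∪ p.2), h p U ≤
        4 ^ r * ∑ V ∈ univ.filter (fun V => V ⊆ p.1 ∩ p.2), h p V + 2 ^ k * c := by
    intro p hp
    rw [mem_product, mem_small, mem_small] at hp
    have h1 : ∀ U ∈ univ.filter (fun U => U ⊆ p.1 ∪ p.2), h p U ≤ h p (p.1 ∩ (U ∩ p.2)) + c := by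
      intro U _
      refine (hM.ex_cond_mul_cond_le U (meas_sqLevel p.1) (meas_sqLevel p.2)).trans ?_
      refine add_le_add le_rfl (mul_le_mul_of_nonneg_left ?_ (by positivity))
      exact mul_le_mul (hf.nrm_sqLevel_le hp.1) (hf.nrm_sqLevel_le hp.2) (M.nrm_nonneg _)
        (by positivity)
    refine (sum_le_sum h1).trans ?_
    rw [sum_add_distrib, sum_const, nsmul_eq_mul]
    refine add_le_add ?_ (mul_le_mul_of_nonneg_right (card_le_two_pow _) hc0)
    have hmaps : ∀ U ∈ univ.filter (fun U => U ⊆ p.1 ∪ p.2),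
        p.1 ∩ (U ∩ p.2) ∈ univ.filter (fun V => V ⊆ p.1 ∩ p.2) := by
      intro U _
      simp only [mem_filter, mem_univ, true_and]
      exact inter_subset_inter_left inter_subset_right
    rw [← sum_fiberwise_of_maps_to hmaps, mul_sum]
    refine sum_le_sum fun V _ => ?_
    rw [sum_congr rfl (g := fun _ => h p V) (fun U hU => by rw [(mem_filter.1 hU).2]), sum_const,
      nsmul_eq_mul]
    refine mul_le_mul_of_nonneg_right ?_ (hnn p V)
    have h2 : univ.filter (fun U => U ⊆ p.1 ∪ p.2) = (p.1 ∪ p.2).powerset := by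
      ext; rw [mem_filter, mem_powerset]; simp
    rw [h2]
    refine (Nat.cast_le.2 (card_filter_le _ _)).trans ?_
    rw [card_powerset]
    push_cast
    have h3 := card_union_le p.1 p.2
    calc (2 : ℝ) ^ #(p.1 ∪ p.2) ≤ 2 ^ (2 * r) := pow_le_pow_right₀ (by norm_num) (by omega)
      _ = 4 ^ r := by rw [pow_mul]; norm_num
  have hL : ∑ U : Finset (Fin k), ∑ p ∈ (small k r ×ˢ small k r).filter (fun p => U ⊆ p.1 ∪ p.2),
      h p U = ∑ p ∈ small k r ×ˢ small k r, ∑ U ∈ univ.filter (fun U => U ⊆ p.1 ∪ p.2), h p U :=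
    sum_comm' (by simp [and_comm])
  have hR : ∑ V : Finset (Fin k), M.ex (M.energy f r V * M.energy f r V) =
      ∑ p ∈ small k r ×ˢ small k r, ∑ V ∈ univ.filter (fun V => V ⊆ p.1 ∩ p.2), h p V := by
    simp only [ex_energy_sq_eq]
    exact sum_comm' (by simp [and_comm])
  rw [hL, hR]
  refine (sum_le_sum hpair).trans ?_
  rw [sum_add_distrib, ← mul_sum, sum_const, nsmul_eq_mul]
  refine add_le_add le_rfl ?_
  have hcard : (#(small k r ×ˢ small k r) : ℝ) ≤ (2 ^ k) ^ 2 := by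
    rw [card_product, Nat.cast_mul, sq]
    exact mul_le_mul (card_le_two_pow _) (card_le_two_pow _) (by positivity) (by positivity)
  refine (mul_le_mul_of_nonneg_right hcard (by positivity)).trans (le_of_eq ?_)
  rw [hc]; ring

theorem sum_ex_energy_le :
    ∑ V : Finset (Fin k), M.ex (M.energy f r V) ≤
      2 ^ r * ∑ S ∈ small k r, M.ex (M.sqLevel f S) := by
  have h1 : ∀ V, M.ex (M.energy f r V) =
      ∑ S ∈ (small k r).filter (V ⊆ ·), M.ex (M.sqLevel f S) := by
    intro V
    rw [energy, map_sum]
    exact sum_congr rfl fun S _ => M.ex_cond V _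
  simp only [h1]
  rw [sum_comm' (t' := small k r) (s' := fun S => univ.filter (· ⊆ S)) (by simp [and_comm]), mul_sum]
  refine sum_le_sum fun S hS => ?_
  rw [sum_const, nsmul_eq_mul]
  refine mul_le_mul_of_nonneg_right ?_ (M.ex_nonneg (sqLevel_nonneg S))
  have h2 : univ.filter (· ⊆ S) = S.powerset := by ext; simp
  rw [h2, card_powerset]
  push_cast
  exact pow_le_pow_right₀ (by norm_num) (mem_small.1 hS).le

/-- The fourth moment of the low-level part of a spread function. -/
theorem Spread.ex_lowPart_pow_four_le (hf : M.Spread f r δ) (hM : M.IsApprox κ) (hκ : 0 ≤ κ)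
    (hκ1 : (2 ^ k) ^ 3 * κ ≤ 1 / 2) :
    M.ex (M.lowPart f r * M.lowPart f r * (M.lowPart f r * M.lowPart f r)) ≤
      4 * 8192 ^ r * δ * ∑ S ∈ small k r, M.ex (M.sqLevel f S) +
        20 * (2 ^ k) ^ 19 * κ * δ ^ 2 * M.nrm f ^ 2 := by
  have hδ := hf.nonneg
  have hn := M.nrm_nonneg f
  set F2 := M.lowPart f r * M.lowPart f r with hF2
  set D : ℝ := 2 ^ k with hD
  have hD1 : 1 ≤ D := one_le_pow₀ (by norm_num)
  set B := ∑ S ∈ small k r, M.ex (M.sqLevel f S) with hB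
  have hB0 : 0 ≤ B := sum_nonneg fun S _ => M.ex_nonneg (sqLevel_nonneg S)
  set Z : Finset (Fin k) → Ω → ℝ := fun U =>
    ∑ p ∈ goodPairs k r U, M.level ∅ p.1 f * M.level ∅ p.2 f with hZ
  have e1 : M.ex (F2 * F2) = ∑ U : Finset (Fin k), M.ex (F2 * M.level ∅ U F2) := by
    have := M.sum_level ∅ F2
    rw [compl_empty, powerset_univ] at this
    conv_lhs => rw [← this]
    rw [this, ← map_sum, ← mul_sum, this]
  have e2 : ∀ U : Finset (Fin k), M.ex (F2 * M.level ∅ U F2) ≤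
      2 * M.nrm (M.level ∅ U (Z U)) ^ 2 + (2 * (D ^ 5 * κ * δ * M.nrm f) ^ 2 +
        D * D * κ * M.ex (F2 * F2)) := by
    intro U
    have h1 := (abs_le.1 (hM.abs_ex_level_sub_le hκ (disjoint_empty_right U) F2 F2)).1
    have h2 := hf.nrm_level_lowPart_sq_le hM hκ U
    rw [← nrm_sq, ← sq (M.nrm F2), M.nrm_sq F2] at h1
    have h3 := pow_le_pow_left₀ (M.nrm_nonneg _) h2 2
    have h4 := two_mul_le_add_sq (M.nrm (M.level ∅ U (Z U))) (D ^ 5 * κ * δ * M.nrm f)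
    linarith
  have e3 : M.ex (F2 * F2) ≤ 2 * (∑ U : Finset (Fin k), M.nrm (M.level ∅ U (Z U)) ^ 2) +
      D * (2 * (D ^ 5 * κ * δ * M.nrm f) ^ 2 + D * D * κ * M.ex (F2 * F2)) := by
    conv_lhs => rw [e1]
    refine (sum_le_sum fun U _ => e2 U).trans ?_
    rw [sum_add_distrib, ← mul_sum, sum_const, nsmul_eq_mul]
    simp [hD]
  have e4 : ∑ U : Finset (Fin k), M.nrm (M.level ∅ U (Z U)) ^ 2 ≤
      256 ^ r * (4 ^ r * ∑ V : Finset (Fin k), M.ex (M.energy f r V * M.energy f r V) +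
        2 * D ^ 7 * κ * δ ^ 2 * M.nrm f ^ 2) := by
    refine (sum_le_sum fun U _ => nrm_level_goodPairs_sq_le U).trans ?_
    rw [← mul_sum]
    exact mul_le_mul_of_nonneg_left (hf.sum_ex_cond_sqLevel_le hM hκ) (by positivity)
  have e5 : ∑ V : Finset (Fin k), M.ex (M.energy f r V * M.energy f r V) ≤
      4 ^ r * (δ * (2 ^ r * B) + D * (2 * D ^ 6 * κ * δ ^ 2 * M.nrm f ^ 2)) := by
    refine (sum_le_sum fun V _ => hf.ex_energy_sq_le hM hκ V).trans ?_
    rw [← mul_sum, sum_add_distrib, ← mul_sum, sum_const, nsmul_eq_mul]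
    have := mul_le_mul_of_nonneg_left (sum_ex_energy_le (M := M) (f := f) (r := r)) hδ
    refine mul_le_mul_of_nonneg_left (add_le_add this (le_of_eq ?_)) (by positivity)
    simp [hD]
  set m := M.nrm f ^ 2 with hm
  have hm0 : 0 ≤ m := sq_nonneg _
  have e6 : ∑ U : Finset (Fin k), M.nrm (M.level ∅ U (Z U)) ^ 2 ≤
      8192 ^ r * δ * B + 4 * D ^ 19 * (κ * δ ^ 2 * m) := by
    have p1 : (256 : ℝ) ^ r * 4 ^ r * 4 ^ r * 2 ^ r = 8192 ^ r := by
      rw [← mul_pow, ← mul_pow, ← mul_pow]; norm_num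
    have p2 : (256 : ℝ) ^ r ≤ D ^ 8 := by
      rw [hD, ← pow_mul, mul_comm, pow_mul]; norm_num
      exact pow_le_pow_right₀ (by norm_num) hf.le_dim
    have p3 : (4 : ℝ) ^ r * 4 ^ r ≤ D ^ 4 := by
      rw [hD, ← pow_mul, mul_comm k 4, pow_mul, ← mul_pow]; norm_num
      exact pow_le_pow_right₀ (by norm_num) hf.le_dim
    have p4 : (256 : ℝ) ^ r * (4 ^ r * 4 ^ r) ≤ D ^ 12 := by
      calc _ ≤ D ^ 8 * D ^ 4 := by gcongr
        _ = _ := by ring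
    have p5 : D ^ 8 ≤ D ^ 12 := pow_le_pow_right₀ hD1 (by norm_num)
    have q : 0 ≤ D ^ 7 * (κ * δ ^ 2 * m) := by positivity
    calc _ ≤ 256 ^ r * (4 ^ r * (4 ^ r * (δ * (2 ^ r * B) + D * (2 * D ^ 6 * κ * δ ^ 2 * m))) +
        2 * D ^ 7 * κ * δ ^ 2 * m) := e4.trans (by gcongr)
      _ = (256 ^ r * 4 ^ r * 4 ^ r * 2 ^ r) * δ * B +
          2 * (256 ^ r * (4 ^ r * 4 ^ r)) * (D ^ 7 * (κ * δ ^ 2 * m)) +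
          2 * 256 ^ r * (D ^ 7 * (κ * δ ^ 2 * m)) := by ring
      _ ≤ 8192 ^ r * δ * B + 2 * D ^ 12 * (D ^ 7 * (κ * δ ^ 2 * m)) +
          2 * D ^ 12 * (D ^ 7 * (κ * δ ^ 2 * m)) := by
        rw [p1]; gcongr; exact p2.trans p5
      _ = _ := by ring
  have hE := M.ex_nonneg (pi_mul_self_nonneg F2)
  have e7 : D * (D * D * κ * M.ex (F2 * F2)) ≤ 1 / 2 * M.ex (F2 * F2) := by
    have := mul_le_mul_of_nonneg_right hκ1 hE
    linarith
  have e8 : D * (2 * (D ^ 5 * κ * δ * M.nrm f) ^ 2) ≤ 2 * D ^ 19 * (κ * δ ^ 2 * m) := by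
    have hκ2 : D ^ 11 * κ ≤ D ^ 19 := by
      calc D ^ 11 * κ = D ^ 8 * (D ^ 3 * κ) := by ring
        _ ≤ D ^ 8 * 1 := by gcongr; linarith
        _ ≤ D ^ 19 := by rw [mul_one]; exact pow_le_pow_right₀ hD1 (by norm_num)
    calc _ = 2 * (D ^ 11 * κ) * (κ * δ ^ 2 * m) := by rw [hm]; ring
      _ ≤ _ := by gcongr
  nlinarith

end CondSystem

namespace CondSystem

variable {Ω : Type*} [Fintype Ω] {k : ℕ} {M : CondSystem Ω k} {f : Ω → ℝ} {r : ℕ} {δ κ : ℝ}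

theorem ex_mul_lowPart_pow_four_le (hf : f * f = f) (F : Ω → ℝ) :
    M.ex (f * F) ^ 4 ≤ M.ex f ^ 3 * M.ex (F * F * (F * F)) := by
  have hf0 : 0 ≤ M.ex f := by rw [← hf]; exact M.ex_nonneg (pi_mul_self_nonneg f)
  have h1 := M.ex_mul_sq_le f (f * F)
  have h2 := M.ex_mul_sq_le f (F * F)
  rw [← mul_assoc, hf, show f * F * (f * F) = f * f * (F * F) by ring, hf] at h1
  rw [hf] at h2
  calc M.ex (f * F) ^ 4 = (M.ex (f * F) ^ 2) ^ 2 := by ring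
    _ ≤ (M.ex f * M.ex (f * (F * F))) ^ 2 := pow_le_pow_left₀ (sq_nonneg _) h1 2
    _ = M.ex f ^ 2 * M.ex (f * (F * F)) ^ 2 := by ring
    _ ≤ M.ex f ^ 2 * (M.ex f * M.ex (F * F * (F * F))) := by gcongr
    _ = _ := by ring

theorem sum_noise_eq (ρ : ℝ) (g h : Ω → ℝ) :
    ∑ S : Finset (Fin k), ρ ^ #S * (1 - ρ) ^ (k - #S) * M.ex (g * M.cond S h) =
      ∑ S : Finset (Fin k), ρ ^ #S * M.ex (g * M.level ∅ S h) := by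
  have := sum_powerset_pow_smul_sum_sign ρ (fun T => M.ex (g * M.cond T h)) (univ : Finset (Fin k))
  rw [powerset_univ] at this
  simp only [smul_eq_mul, card_univ_sdiff, Fintype.card_fin] at this
  rw [← this]
  refine sum_congr rfl fun S _ => ?_
  congr 1
  rw [level_apply, mul_sum, map_sum]
  refine sum_congr rfl fun T _ => ?_
  rw [mul_smul_comm, map_smul, smul_eq_mul, empty_union]

theorem sum_noise_weight (ρ : ℝ) :
    ∑ S : Finset (Fin k), ρ ^ #S * (1 - ρ) ^ (k - #S) = 1 := by
  have := Fintype.sum_pow_mul_eq_add_pow (Fin k) ρ (1 - ρ)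
  simpa using this

theorem ex_mul_level_ge (hM : M.IsApprox κ) (hκ : 0 ≤ κ) (S : Finset (Fin k)) :
    M.ex (M.sqLevel f S) ≤ M.ex (f * M.level ∅ S f) + (2 ^ k) ^ 2 * κ * M.nrm f ^ 2 := by
  have h := (abs_le.1 (hM.abs_ex_level_sub_le hκ (disjoint_empty_right S) f f)).2
  rw [sqLevel]
  linarith

/-- The noise stability is controlled by the correlation with the low-level part. -/
theorem sum_noise_le (hM : M.IsApprox κ) (hκ : 0 ≤ κ) {ρ : ℝ} (hρ0 : 0 ≤ ρ) (hρ1 : ρ ≤ 1) :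
    ∑ S : Finset (Fin k), ρ ^ #S * (1 - ρ) ^ (k - #S) * M.ex (f * M.cond S f) ≤
      M.ex (f * M.lowPart f r) + (ρ ^ r + 2 * (2 ^ k) ^ 3 * κ) * M.nrm f ^ 2 := by
  set c := (2 ^ k) ^ 2 * κ * M.nrm f ^ 2 with hc
  have hc0 : 0 ≤ c := by positivity
  have hnn : ∀ S : Finset (Fin k), 0 ≤ M.ex (f * M.level ∅ S f) + c := fun S =>
    (M.ex_nonneg (sqLevel_nonneg S)).trans (ex_mul_level_ge hM hκ S)
  have hterm : ∀ S : Finset (Fin k), ρ ^ #S * M.ex (f * M.level ∅ S f) ≤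
      (if S ∈ small k r then M.ex (f * M.level ∅ S f) + c else 0) +
        ρ ^ r * (M.ex (f * M.level ∅ S f) + c) := by
    intro S
    have h1 : ρ ^ #S * M.ex (f * M.level ∅ S f) ≤ ρ ^ #S * (M.ex (f * M.level ∅ S f) + c) := by
      gcongr; linarith
    split_ifs with hS
    · have h2 := mul_le_mul_of_nonneg_right (pow_le_one₀ (n := #S) hρ0 hρ1) (hnn S)
      have h3 := mul_nonneg (pow_nonneg hρ0 r) (hnn S)
      linarith
    · rw [mem_small, not_lt] at hS
      have h2 := mul_le_mul_of_nonneg_right (pow_le_pow_of_le_one hρ0 hρ1 hS) (hnn S)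
      linarith
  rw [sum_noise_eq]
  refine (sum_le_sum fun S _ => hterm S).trans ?_
  have hall : ∑ S : Finset (Fin k), M.ex (f * M.level ∅ S f) = M.nrm f ^ 2 := by
    have := M.sum_level ∅ f
    rw [compl_empty, powerset_univ] at this
    rw [← map_sum, ← mul_sum, this, nrm_sq]
  have hlow : ∑ S ∈ small k r, M.ex (f * M.level ∅ S f) = M.ex (f * M.lowPart f r) := by
    rw [← map_sum, ← mul_sum, lowPart]
  rw [sum_add_distrib, sum_ite_mem, univ_inter, sum_add_distrib, hlow,
    ← mul_sum univ _ (ρ ^ r), sum_add_distrib, hall, sum_const, sum_const, nsmul_eq_mul, nsmul_eq_mul]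
  have c1 := mul_le_mul_of_nonneg_right (card_le_two_pow (small k r)) hc0
  have c2 := mul_le_mul_of_nonneg_right (card_le_two_pow (univ : Finset (Finset (Fin k)))) hc0
  have c3 := mul_le_mul_of_nonneg_right (pow_le_one₀ (n := r) hρ0 hρ1)
    (show 0 ≤ 2 ^ k * c by positivity)
  have c4 := mul_le_mul_of_nonneg_left c2 (pow_nonneg hρ0 r)
  have c5 : 2 ^ k * c = (2 ^ k) ^ 3 * κ * M.nrm f ^ 2 := by rw [hc]; ring
  linarith

theorem Spread.ex_mul_lowPart_le (hf : M.Spread f r δ) (hM : M.IsApprox κ) (hκ : 0 ≤ κ)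
    {ε : ℝ} (hε : 0 < ε) (hε1 : ε ≤ 1) (hr : 3 ≤ r) (hδ : δ * 2 ^ (20 * r) ≤ ε ^ 3)
    (hκε : 4 * (2 ^ k) ^ 19 * κ ≤ ε) :
    M.ex (f * M.lowPart f r) ≤ ε / 4 * M.ex f := by
  have hδ0 := hf.nonneg
  set m := M.ex f with hm
  have hm2 : M.nrm f ^ 2 = m := hf.ex_eq.symm
  have hm0 : 0 ≤ m := by rw [← hm2]; positivity
  set W := M.ex (f * M.lowPart f r) with hW
  set B := ∑ S ∈ small k r, M.ex (M.sqLevel f S) with hB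
  set D : ℝ := 2 ^ k with hD
  have hD2 : 2 ≤ D := by
    calc (2 : ℝ) = 2 ^ 1 := by norm_num
      _ ≤ 2 ^ k := pow_le_pow_right₀ (by norm_num) (by have := hf.le_dim; omega)
  have hD16 : 2 ≤ D ^ 16 := by
    calc (2 : ℝ) ≤ 2 ^ 16 := by norm_num
      _ ≤ D ^ 16 := by gcongr
  have hDκ : D ^ 3 * κ ≤ ε / 8 := by
    have h1 : D ^ 3 * κ * 2 ≤ D ^ 3 * κ * D ^ 16 := by gcongr
    have h2 : D ^ 3 * κ * D ^ 16 = D ^ 19 * κ := by ring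
    linarith
  have hBW : B ≤ W + D ^ 3 * κ * m := by
    have h1 : B ≤ ∑ S ∈ small k r, (M.ex (f * M.level ∅ S f) + D ^ 2 * κ * M.nrm f ^ 2) :=
      sum_le_sum fun S _ => ex_mul_level_ge hM hκ S
    rw [sum_add_distrib, ← map_sum, ← mul_sum, sum_const, nsmul_eq_mul, hm2] at h1
    have h2 := mul_le_mul_of_nonneg_right (card_le_two_pow (small k r))
      (show 0 ≤ D ^ 2 * κ * m by positivity)
    rw [hW, lowPart]
    linarith
  by_contra! hlt
  have hW0 : 0 < W := lt_of_le_of_lt (by positivity) hlt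
  have hmW : ε * m ≤ 4 * W := by linarith
  have h4 := ex_mul_lowPart_pow_four_le (M := M) hf.bool (M.lowPart f r)
  have hF := hf.ex_lowPart_pow_four_le hM hκ (by rw [← hD]; linarith)
  rw [← hB, ← hD, hm2] at hF
  have hB2 : B ≤ 2 * W := by
    have := mul_le_mul_of_nonneg_right hDκ hm0
    linarith
  set q := δ * 8192 ^ r with hq
  have hq0 : 0 ≤ q := by positivity
  have hr1 : (20 : ℝ) ≤ 8192 ^ r := by
    calc (20 : ℝ) ≤ 8192 ^ 1 := by norm_num
      _ ≤ 8192 ^ r := pow_le_pow_right₀ (by norm_num) (by omega)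
  have hδ20 : 20 * δ ≤ q := by rw [hq, mul_comm]; gcongr
  have hqε : q * 2 ^ 21 ≤ ε ^ 3 := by
    refine le_trans ?_ hδ
    have h1 : (2 : ℝ) ^ (20 * r) = 8192 ^ r * 2 ^ (7 * r) := by
      rw [show (8192 : ℝ) = 2 ^ 13 by norm_num, ← pow_mul, ← pow_add]; congr 1; ring
    have h2 : (2 : ℝ) ^ 21 ≤ 2 ^ (7 * r) := pow_le_pow_right₀ (by norm_num) (by omega)
    rw [h1, ← mul_assoc]
    gcongr
  have hδ1 : δ ≤ 1 := by
    have h1 : (1 : ℝ) ≤ 2 ^ (20 * r) := one_le_pow₀ (by norm_num)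
    have h2 : δ * 1 ≤ δ * 2 ^ (20 * r) := by gcongr
    have h3 : ε ^ 3 ≤ 1 := pow_le_one₀ hε.le hε1
    linarith
  have hF2 : M.ex (M.lowPart f r * M.lowPart f r * (M.lowPart f r * M.lowPart f r)) ≤
      9 * q * W := by
    have h1 : 4 * 8192 ^ r * δ * B ≤ 8 * q * W := by
      calc _ = 4 * q * B := by rw [hq]; ring
        _ ≤ 4 * q * (2 * W) := by gcongr
        _ = _ := by ring
    have h2 : 20 * D ^ 19 * κ * δ ^ 2 * m ≤ q * W := by
      calc 20 * D ^ 19 * κ * δ ^ 2 * m = 5 * (4 * D ^ 19 * κ) * (δ ^ 2 * m) := by ring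
        _ ≤ 5 * ε * (δ ^ 2 * m) := by gcongr
        _ = 5 * δ * δ * (ε * m) := by ring
        _ ≤ 5 * δ * 1 * (4 * W) := by gcongr
        _ = 20 * δ * W := by ring
        _ ≤ q * W := by gcongr
    linarith
  have hmW3 : (ε * m) ^ 3 ≤ (4 * W) ^ 3 := pow_le_pow_left₀ (by positivity) hmW 3
  have h5 : W ^ 4 * 2 ^ 21 ≤ 576 * W ^ 4 := by
    calc W ^ 4 * 2 ^ 21 ≤ m ^ 3 * (9 * q * W) * 2 ^ 21 := by
          gcongr; exact h4.trans (by gcongr)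
      _ = 9 * m ^ 3 * W * (q * 2 ^ 21) := by ring
      _ ≤ 9 * m ^ 3 * W * ε ^ 3 := by gcongr
      _ = 9 * W * (ε * m) ^ 3 := by ring
      _ ≤ 9 * W * (4 * W) ^ 3 := by gcongr
      _ = 576 * W ^ 4 := by ring
  have h6 : 0 < W ^ 4 := by positivity
  linarith

/-- Spread functions are noise sensitive. -/
theorem Spread.sum_noise_le_mul (hf : M.Spread f r δ) (hM : M.IsApprox κ) (hκ : 0 ≤ κ)
    {ρ ε : ℝ} (hρ0 : 0 ≤ ρ) (hρ1 : ρ ≤ 1) (hε : 0 < ε) (hε1 : ε ≤ 1) (hr : 3 ≤ r)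
    (hδ : δ * 2 ^ (20 * r) ≤ ε ^ 3) (hκε : 4 * (2 ^ k) ^ 19 * κ ≤ ε) (hρ : ρ ^ r ≤ ε / 2) :
    ∑ S : Finset (Fin k), ρ ^ #S * (1 - ρ) ^ (k - #S) * M.ex (f * M.cond S f) ≤ ε * M.ex f := by
  have h1 := sum_noise_le (M := M) (f := f) (r := r) hM hκ hρ0 hρ1
  have h2 := hf.ex_mul_lowPart_le hM hκ hε hε1 hr hδ hκε
  rw [← hf.ex_eq] at h1
  have hm0 : 0 ≤ M.ex f := M.ex_nonneg hf.f_nonneg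
  have hD2 : (2 : ℝ) ≤ 2 ^ k := by
    calc (2 : ℝ) = 2 ^ 1 := by norm_num
      _ ≤ 2 ^ k := pow_le_pow_right₀ (by norm_num) (by have := hf.le_dim; omega)
  have hD16 : (2 : ℝ) ≤ (2 ^ k) ^ 16 := by
    calc (2 : ℝ) ≤ 2 ^ 16 := by norm_num
      _ ≤ (2 ^ k) ^ 16 := by gcongr
  have hDκ : 2 * (2 ^ k) ^ 3 * κ ≤ ε / 4 := by
    have h1 : (2 ^ k) ^ 3 * κ * 2 ≤ (2 ^ k) ^ 3 * κ * (2 ^ k) ^ 16 := by gcongr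
    have h2 : ((2 : ℝ) ^ k) ^ 3 * κ * (2 ^ k) ^ 16 = (2 ^ k) ^ 19 * κ := by ring
    linarith
  have h3 := mul_le_mul_of_nonneg_right (add_le_add hρ hDκ) hm0
  linarith

theorem sum_noise_le_ex (hf : f * f = f) {ρ : ℝ} (hρ0 : 0 ≤ ρ) (hρ1 : ρ ≤ 1) :
    ∑ S : Finset (Fin k), ρ ^ #S * (1 - ρ) ^ (k - #S) * M.ex (f * M.cond S f) ≤ M.ex f := by
  have h1 : ∀ S, M.ex (f * M.cond S f) ≤ M.ex f := by
    intro S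
    have h2 : M.nrm f * M.nrm f = M.ex f := by rw [← sq, nrm_sq, hf]
    rw [← h2]
    exact (M.ex_mul_le _ _).trans (mul_le_mul_of_nonneg_left (M.nrm_cond_le S f) (M.nrm_nonneg f))
  have hρ2 : 0 ≤ 1 - ρ := by linarith
  refine (sum_le_sum fun S _ => mul_le_mul_of_nonneg_left (h1 S) (by positivity)).trans ?_
  rw [← sum_mul, sum_noise_weight, one_mul]

end CondSystem

namespace CondSystem

section Coordinates

variable {Ω A : Type*} [Fintype Ω] [DecidableEq A] {k : ℕ} (μ : Ω → ℝ) (c : Ω → Fin k → A)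

/-- The points agreeing with `x` on the coordinates in `S`. -/
def agree (S : Finset (Fin k)) (x : Ω) : Finset Ω := univ.filter fun y => ∀ i ∈ S, c y i = c x i

/-- The conditional expectation given the coordinates in `S`. -/
noncomputable def coordCond (S : Finset (Fin k)) : (Ω → ℝ) →ₗ[ℝ] (Ω → ℝ) where
  toFun h x := (∑ y ∈ agree c S x, μ y * h y) / ∑ y ∈ agree c S x, μ y
  map_add' g h := by
    ext x; simp only [Pi.add_apply, mul_add, sum_add_distrib, add_div]
  map_smul' a h := by
    ext x
    simp only [Pi.smul_apply, smul_eq_mul, RingHom.id_apply, ← mul_div_assoc, mul_sum]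
    congr 1
    exact sum_congr rfl fun y _ => by ring

variable {μ c}

theorem coordCond_apply (S : Finset (Fin k)) (h : Ω → ℝ) (x : Ω) :
    coordCond μ c S h x = (∑ y ∈ agree c S x, μ y * h y) / ∑ y ∈ agree c S x, μ y := rfl

theorem mem_agree {S : Finset (Fin k)} {x y : Ω} : y ∈ agree c S x ↔ ∀ i ∈ S, c y i = c x i := by
  simp [agree]

theorem mem_agree_self (S : Finset (Fin k)) (x : Ω) : x ∈ agree c S x :=
  mem_agree.2 fun _ _ => rfl

theorem agree_comm {S : Finset (Fin k)} {x y : Ω} : y ∈ agree c S x ↔ x ∈ agree c S y := by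
  simp only [mem_agree, eq_comm]

theorem agree_congr {S : Finset (Fin k)} {x y : Ω} (h : y ∈ agree c S x) :
    agree c S y = agree c S x := by
  ext z
  simp only [mem_agree] at h ⊢
  exact forall₂_congr fun i hi => by rw [h i hi]

theorem agree_anti {S T : Finset (Fin k)} (hST : S ⊆ T) (x : Ω) : agree c T x ⊆ agree c S x :=
  fun _ hy => mem_agree.2 fun i hi => mem_agree.1 hy i (hST hi)

theorem sum_agree_pos (hμ : ∀ ω, 0 < μ ω) (S : Finset (Fin k)) (x : Ω) :
    0 < ∑ y ∈ agree c S x, μ y :=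
  sum_pos (fun y _ => hμ y) ⟨x, mem_agree_self S x⟩

theorem coordCond_congr {S : Finset (Fin k)} {x y : Ω} (h : y ∈ agree c S x) (g : Ω → ℝ) :
    coordCond μ c S g y = coordCond μ c S g x := by
  rw [coordCond_apply, coordCond_apply, agree_congr h]

theorem coordCond_mul_of_invariant {S : Finset (Fin k)} {g : Ω → ℝ}
    (hg : ∀ x, ∀ y ∈ agree c S x, g y = g x) (h : Ω → ℝ) :
    coordCond μ c S (h * g) = coordCond μ c S h * g := by
  ext x
  rw [Pi.mul_apply, coordCond_apply, coordCond_apply, div_mul_eq_mul_div, sum_mul]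
  congr 1
  refine sum_congr rfl fun y hy => ?_
  rw [Pi.mul_apply, hg x y hy, mul_assoc]

theorem coordCond_one (hμ : ∀ ω, 0 < μ ω) (S : Finset (Fin k)) : coordCond μ c S 1 = 1 := by
  ext x
  simp [coordCond_apply, (sum_agree_pos hμ S x).ne']

theorem coordCond_of_invariant (hμ : ∀ ω, 0 < μ ω) {S : Finset (Fin k)} {g : Ω → ℝ}
    (hg : ∀ x, ∀ y ∈ agree c S x, g y = g x) : coordCond μ c S g = g := by
  have := coordCond_mul_of_invariant (μ := μ) hg 1
  rwa [one_mul, coordCond_one hμ, one_mul] at this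

theorem coordCond_symm (S : Finset (Fin k)) (g h : Ω → ℝ) :
    ∑ ω, μ ω * (g ω * coordCond μ c S h ω) = ∑ ω, μ ω * (coordCond μ c S g ω * h ω) := by
  have h1 : ∀ (g h : Ω → ℝ), ∑ x, μ x * (g x * coordCond μ c S h x) =
      ∑ x, ∑ y ∈ agree c S x, μ x * μ y * g x * h y / ∑ z ∈ agree c S x, μ z := by
    intro g h
    refine sum_congr rfl fun x _ => ?_
    rw [coordCond_apply, ← mul_div_assoc, ← mul_div_assoc, mul_sum, mul_sum, sum_div]
    exact sum_congr rfl fun y _ => by ring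
  simp only [mul_comm (coordCond μ c S g _)]
  rw [h1, h1, sum_comm' (t' := univ) (s' := fun y => agree c S y) (by simp [agree_comm])]
  refine sum_congr rfl fun y _ => sum_congr rfl fun x hx => ?_
  rw [agree_congr hx]
  ring

theorem coordCond_coordCond_of_subset (hμ : ∀ ω, 0 < μ ω) {S T : Finset (Fin k)} (hST : S ⊆ T)
    (h : Ω → ℝ) : coordCond μ c S (coordCond μ c T h) = coordCond μ c S h := by
  classical
  ext x
  rw [coordCond_apply, coordCond_apply]
  congr 1
  set g : Ω → ℝ := fun y => if y ∈ agree c S x then 1 else 0 with hg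
  have hinv : coordCond μ c T g = g := by
    refine coordCond_of_invariant hμ fun y z hz => ?_
    have h1 : z ∈ agree c S x ↔ y ∈ agree c S x := by
      rw [agree_comm, agree_congr (agree_anti hST y hz), agree_comm]
    simp only [hg, h1]
  have h2 : ∀ u : Ω → ℝ, ∑ y ∈ agree c S x, μ y * u y = ∑ y, μ y * (g y * u y) := by
    intro u
    simp [hg]
  rw [h2, h2, coordCond_symm, hinv]

/-- The system of conditional expectations given coordinates on a finite positively weighted
space. -/
noncomputable def ofCoords (μ : Ω → ℝ) (hμ : ∀ ω, 0 < μ ω) (c : Ω → Fin k → A)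
    (hc : Function.Injective c) : CondSystem Ω k where
  μ := μ
  μ_nonneg ω := (hμ ω).le
  cond := coordCond μ c
  cond_symm := coordCond_symm
  cond_cond_of_subset h hST := coordCond_coordCond_of_subset hμ hST h
  cond_cond_of_superset h hST := coordCond_of_invariant hμ fun x _ hy =>
    coordCond_congr (agree_anti hST x hy) h
  cond_mul_cond _ g h := coordCond_mul_of_invariant (fun _ _ hy => coordCond_congr hy h) g
  cond_nonneg S h hh x := div_nonneg
    (sum_nonneg fun y _ => mul_nonneg (hμ y).le (hh y)) (sum_nonneg fun y _ => (hμ y).le)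
  cond_one := coordCond_one hμ
  cond_univ h := coordCond_of_invariant hμ fun x y hy => by
    rw [hc (funext fun i => mem_agree.1 hy i (mem_univ i))]

end Coordinates

section Correlation

variable {Ω : Type*} [Fintype Ω] {k : ℕ} {M : CondSystem Ω k}

/-- A correlation bound for centred functions of one private coordinate each gives the
approximate composition property for one private coordinate each. -/
theorem nrm_cond_cond_sub_le_of_corr {γ : ℝ} (hγ : 0 ≤ γ) {S : Finset (Fin k)} {i j : Fin k}
    (H : ∀ g h, M.Meas (insert i S) g → M.Meas (insert j S) h → M.cond S g = 0 →
      M.cond S h = 0 → M.ex (g * h) ≤ γ / 2 * (M.ex (g * g) + M.ex (h * h))) (h : Ω → ℝ) :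
    M.nrm (M.cond (insert i S) (M.cond (insert j S) h) - M.cond S h) ≤ γ * M.nrm h := by
  set h' := M.cond (insert j S) h - M.cond S h with hh'
  have hSi := subset_insert i S
  have hSj := subset_insert j S
  have hm' : M.Meas (insert j S) h' := by
    unfold Meas
    rw [hh', map_sub, cond_cond, M.cond_cond_of_superset h hSj]
  have hc' : M.cond S h' = 0 := by
    rw [hh', map_sub, M.cond_cond_of_subset h hSj, cond_cond, sub_self]
  set g := M.cond (insert i S) h' with hg
  have hgm : M.Meas (insert i S) g := M.meas_cond _ _
  have hgc : M.cond S g = 0 := by rw [hg, M.cond_cond_of_subset _ hSi, hc']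
  have hge : M.cond (insert i S) (M.cond (insert j S) h) - M.cond S h = g := by
    rw [hg, hh', map_sub, M.cond_cond_of_superset h hSi]
  have hgg : M.ex (g * h') = M.nrm g ^ 2 := by
    rw [nrm_sq]
    conv_rhs => rw [hg]
    rw [ex_mul_cond, ← hg, hgm]
  have hh'h : M.nrm h' ≤ M.nrm h := by
    have h1 : M.ex (h' * h') = M.ex (h' * h) := by
      conv_lhs => rw [hh']
      rw [← hh', mul_sub, map_sub, ex_mul_cond, hm', ex_mul_cond, hc']
      simp
    have h2 : M.nrm h' ^ 2 ≤ M.nrm h' * M.nrm h := by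
      rw [nrm_sq, h1]; exact M.ex_mul_le _ _
    by_contra! hlt
    nlinarith [M.nrm_nonneg h]
  have key : M.nrm g ≤ γ * M.nrm h' := by
    have hg0 := M.nrm_nonneg g
    have hh0 := M.nrm_nonneg h'
    have h1 : ∀ t : ℝ, t * M.nrm g ^ 2 ≤ γ / 2 * (t ^ 2 * M.nrm g ^ 2 + M.nrm h' ^ 2) := by
      intro t
      have h2 := H (t • g) h' (by unfold Meas; rw [map_smul, hgm]) hm'
        (by rw [map_smul, hgc, smul_zero]) hc'
      rwa [smul_mul_assoc, smul_mul_smul_comm, map_smul, map_smul, hgg, smul_eq_mul, smul_eq_mul,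
        ← nrm_sq, ← nrm_sq, ← sq] at h2
    rcases hg0.eq_or_lt with h0 | h0
    · rw [← h0]; positivity
    have h2 := h1 (M.nrm h' / M.nrm g)
    have h3 : M.nrm h' / M.nrm g * M.nrm g ^ 2 = M.nrm h' * M.nrm g := by field_simp
    have h4 : (M.nrm h' / M.nrm g) ^ 2 * M.nrm g ^ 2 = M.nrm h' ^ 2 := by field_simp
    rw [h3, h4] at h2
    rcases hh0.eq_or_lt with h5 | h5
    · have h6 := M.ex_mul_le g h'
      rw [hgg, ← h5] at h6
      nlinarith
    · nlinarith
  rw [hge]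
  exact key.trans (mul_le_mul_of_nonneg_left hh'h hγ)

end Correlation

end CondSystem

theorem image_update_insert {α : Type*} [DecidableEq α] {k : ℕ} {S : Finset (Fin k)} {i : Fin k} (hi : i ∉ S)
    (z : Fin k → α) (u : α) :
    (insert i S).image (Function.update z i u) = insert u (S.image z) := by
  rw [image_insert, Function.update_self]
  congr 1
  exact image_congr fun j hj => Function.update_of_ne (ne_of_mem_of_not_mem hj hi) _ _

section OrderedFaces

variable {α : Type*} [Fintype α] [DecidableEq α]

theorem sum_insert_eq_sum_superset {s : ℕ} {σ : Finset α} (hσ : #σ = s) {F : Finset α → ℝ}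
    (hF : ∀ t, #t ≠ s + 1 → F t = 0) :
    ∑ u, F (insert u σ) = ∑ t with σ ⊆ t, F t := by
  have h1 : ∑ u, F (insert u σ) = ∑ u ∈ σᶜ, F (insert u σ) := by
    refine (sum_subset (subset_univ _) fun u _ hu => hF _ ?_).symm
    rw [insert_eq_of_mem (by simpa using hu)]
    omega
  rw [h1]
  refine sum_of_injOn (fun u => insert u σ) ?_ (fun u _ => by simp) ?_ fun _ _ => rfl
  · intro u hu v hv huv
    exact (insert_inj (by simpa using hu)).1 huv
  · intro t ht hnot
    refine hF _ fun hcard => hnot ?_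
    have hst : σ ⊆ t := by simpa using ht
    obtain ⟨u, hu⟩ := card_eq_one.1 (by rw [card_sdiff_of_subset hst]; omega : #(t \ σ) = 1)
    have hu' : u ∈ t \ σ := by rw [hu]; simp
    refine ⟨u, by simpa using (mem_sdiff.1 hu').2, ?_⟩
    change insert u σ = t
    rw [insert_eq, ← hu, sdiff_union_of_subset hst]

/-- The tuples agreeing with `z` on the coordinates in `S`, split by the value at `i ∉ S`. -/
theorem sum_agree_eq_sum_update {k : ℕ} {S : Finset (Fin k)} {i : Fin k} (hi : i ∉ S)
    (z : Fin k → α) (F : (Fin k → α) → ℝ) :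
    ∑ y with ∀ j ∈ S, y j = z j, F y =
      ∑ u, ∑ y with ∀ j ∈ insert i S, y j = Function.update z i u j, F y := by
  rw [← sum_fiberwise (s := univ.filter fun y : Fin k → α => ∀ j ∈ S, y j = z j)
    (g := fun y => y i)]
  refine sum_congr rfl fun u _ => sum_congr ?_ fun _ _ => rfl
  ext y
  have h : (∀ j ∈ S, y j = Function.update z i u j) ↔ ∀ j ∈ S, y j = z j :=
    forall₂_congr fun j hj => by
      rw [Function.update_of_ne (ne_of_mem_of_not_mem hj hi)]
  simp [h, and_comm]

/-- Summing a compatible family of face functions over ordered faces with a prescribed part. -/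
theorem sum_agree_eq_of_compatible {k : ℕ} {G : ℕ → Finset α → ℝ}
    (hG : ∀ s < k, ∀ σ, #σ ≤ s → ∑ u, G (s + 1) (insert u σ) = (s + 1) * G s σ)
    (S : Finset (Fin k)) (z : Fin k → α) :
    (∑ y with ∀ i ∈ S, y i = z i, G k (univ.image y)) * (#S).factorial =
      k.factorial * G #S (S.image z) := by
  induction hm : k - #S generalizing S z with
  | zero =>
    have hle : #S ≤ k := by simpa using card_le_univ S
    have hS : S = univ := by
      rw [← card_eq_iff_eq_univ, Fintype.card_fin]; omega
    subst hS
    have : (univ.filter fun y : Fin k → α => ∀ i ∈ univ, y i = z i) = {z} := by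
      ext y; simp [funext_iff]
    rw [this]
    simp [mul_comm]
  | succ m ih =>
    obtain ⟨i, hi⟩ : ∃ i, i ∉ S := by
      by_contra! h
      have : S = univ := by ext; simp [h]
      subst this
      simp at hm
    have hc := card_insert_of_notMem hi
    have h1 := fun u => ih (insert i S) (Function.update z i u) (by omega)
    simp only [hc, image_update_insert hi, Nat.factorial_succ] at h1
    have h2 := hG #S (by omega) (S.image z) card_image_le
    have h3 : (∑ y with ∀ j ∈ S, y j = z j, G k (univ.image y)) *
        (((#S + 1) * (#S).factorial : ℕ) : ℝ) = k.factorial * ((#S + 1) * G #S (S.image z)) := by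
      rw [sum_agree_eq_sum_update hi, sum_mul, ← h2, mul_sum]
      exact sum_congr rfl fun u _ => h1 u
    push_cast at h3
    have h4 : ((#S : ℝ) + 1) ≠ 0 := by positivity
    apply mul_left_cancel₀ h4
    linear_combination h3

theorem sum_agree_image {k : ℕ} {h : Finset α → ℝ} (hh : ∀ t, #t ≠ k → h t = 0)
    {S : Finset (Fin k)} {z : Fin k → α} (hz : #(S.image z) = #S) :
    ∑ y with ∀ i ∈ S, y i = z i, h (univ.image y) =
      (k - #S).factorial * ∑ ρ with S.image z ⊆ ρ, h ρ := by
  have key := sum_agree_eq_of_compatible (k := k)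
    (G := fun s σ => if #σ = s then (∑ ρ with σ ⊆ ρ, h ρ) / k.choose s else 0) ?_ S z
  · have h1 : ∀ y : Fin k → α, (if #(univ.image y) = k then
        (∑ ρ with univ.image y ⊆ ρ, h ρ) / (k.choose k : ℝ) else 0) = h (univ.image y) := by
      intro y
      split_ifs with hy
      · rw [sum_eq_single_of_mem (univ.image y) (by simp)]
        · simp
        · intro ρ hρ hne
          refine hh ρ fun hk => hne ?_
          exact (eq_of_subset_of_card_le (by simpa using hρ) (by omega)).symm
      · exact (hh _ hy).symm
    simp only [h1, hz, if_true] at key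
    have hle : #S ≤ k := by simpa using card_le_univ S
    have h2 : ((k.choose #S * (#S).factorial * (k - #S).factorial : ℕ) : ℝ) = k.factorial := by
      rw [Nat.choose_mul_factorial_mul_factorial hle]
    push_cast at h2
    have h3 : (k.choose #S : ℝ) ≠ 0 := by exact_mod_cast (Nat.choose_pos hle).ne'
    have h4 : ((#S).factorial : ℝ) ≠ 0 := by exact_mod_cast (Nat.factorial_pos _).ne'
    rw [← h2] at key
    apply mul_right_cancel₀ h4
    rw [key]
    field_simp
  · intro s hs σ hσ
    rcases hσ.eq_or_lt with hσ | hσ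
    · have h1 : ∀ u, (if #(insert u σ) = s + 1 then (∑ ρ with insert u σ ⊆ ρ, h ρ) /
          (k.choose (s + 1) : ℝ) else 0) =
          ∑ ρ with σ ⊆ ρ, (if u ∈ ρ \ σ then h ρ / k.choose (s + 1) else 0) := by
        intro u
        by_cases hu : u ∈ σ
        · rw [insert_eq_of_mem hu, if_neg (by omega)]
          simp [hu]
        · rw [card_insert_of_notMem hu, if_pos (by omega), sum_div, ← sum_filter, filter_filter]
          refine sum_congr ?_ fun _ _ => rfl
          ext ρ
          simp [insert_subset_iff, hu, and_comm]
      simp only [h1]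
      rw [sum_comm, if_pos hσ, sum_div, mul_sum]
      refine sum_congr rfl fun ρ hρ => ?_
      rw [← sum_filter, sum_const, filter_univ_mem, nsmul_eq_mul]
      by_cases hk : #ρ = k
      · rw [card_sdiff_of_subset (by simpa using hρ), hk, hσ]
        have h5 : (k.choose (s + 1) : ℝ) ≠ 0 := by exact_mod_cast (Nat.choose_pos hs).ne'
        have h6 : (k.choose s : ℝ) ≠ 0 := by exact_mod_cast (Nat.choose_pos hs.le).ne'
        have h7 : ((k.choose (s + 1) * (s + 1) : ℕ) : ℝ) = (k.choose s * (k - s) : ℕ) := by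
          rw [Nat.choose_succ_right_eq]
        push_cast [Nat.cast_sub hs.le] at h7 ⊢
        field_simp
        linear_combination -h ρ * h7
      · rw [hh ρ hk]; simp
    · rw [if_neg hσ.ne, mul_zero]
      refine sum_eq_zero fun u _ => if_neg ?_
      have := card_insert_le u σ
      omega

end OrderedFaces

namespace WSC

variable {n d : ℕ} (X : WSC n d)

theorem w_eq_zero_of_card {i : ℕ} {s : Finset (Fin n)} (h : #s ≠ i) : X.w i s = 0 :=
  X.w_zero i s fun hs => h (X.card_mem i s hs)

theorem sum_w_mul_superset (i : ℕ) (σ : Finset (Fin n)) (h : Cf n) :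
    ∑ t with σ ⊆ t, X.w i t * h t = ∑ t ∈ (X.faces i).filter (fun t => σ ⊆ t), X.w i t * h t := by
  symm
  refine sum_subset (fun t ht => by simpa using (mem_filter.1 ht).2) fun t ht hnot => ?_
  rw [X.w_zero i t, zero_mul]
  simpa [(mem_filter.1 ht).2] using hnot

theorem sum_w_superset (i : ℕ) (σ : Finset (Fin n)) :
    ∑ t with σ ⊆ t, X.w i t = ∑ t ∈ (X.faces i).filter (fun t => σ ⊆ t), X.w i t := by
  simpa using X.sum_w_mul_superset i σ 1

theorem sum_superset_faces {s : ℕ} (hs : s < d) {σ : Finset (Fin n)} (hσ : #σ = s) :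
    ∑ t ∈ (X.faces (s + 1)).filter (fun t => σ ⊆ t), X.w (s + 1) t = (s + 1) * X.w s σ := by
  by_cases hf : σ ∈ X.faces s
  · rw [X.w_rec s hs σ hf]
    field_simp
  · rw [X.w_zero s σ hf, mul_zero]
    refine sum_eq_zero fun t ht => ?_
    rw [mem_filter] at ht
    exact absurd ((X.downward s hs σ).2 ⟨hσ, t, ht.1, ht.2⟩) hf

theorem w_mul_insert_eq_zero {s : ℕ} {σ : Finset (Fin n)} (hσ : #σ < s) (u : Fin n) :
    X.w (s + 1) (insert u σ) = 0 :=
  X.w_eq_zero_of_card (by have := card_insert_le u σ; omega)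

theorem sum_w_insert {s : ℕ} (hs : s < d) {σ : Finset (Fin n)} (hσ : #σ ≤ s) :
    ∑ u, X.w (s + 1) (insert u σ) = (s + 1) * X.w s σ := by
  rcases hσ.eq_or_lt with h | h
  · rw [sum_insert_eq_sum_superset h fun t => X.w_eq_zero_of_card, sum_w_superset,
      X.sum_superset_faces hs h]
  · rw [X.w_eq_zero_of_card h.ne, mul_zero]
    exact sum_eq_zero fun u _ => X.w_mul_insert_eq_zero h u

theorem w_mul_Dop {s : ℕ} (hs : s < d) {σ : Finset (Fin n)} (hσ : #σ ≤ s) (h : Cf n) :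
    ∑ u, X.w (s + 1) (insert u σ) * h (insert u σ) = (s + 1) * (X.w s σ * Dop X s h σ) := by
  rcases hσ.eq_or_lt with hc | hc
  · rw [sum_insert_eq_sum_superset hc (F := fun t => X.w (s + 1) t * h t) fun t ht => by
      rw [X.w_eq_zero_of_card ht, zero_mul], sum_w_mul_superset, Dop, ← mul_assoc,
      ← X.sum_superset_faces hs hc]
    by_cases h0 : ∑ t ∈ (X.faces (s + 1)).filter (fun t => σ ⊆ t), X.w (s + 1) t = 0
    · rw [h0, zero_mul]
      refine sum_eq_zero fun t ht => ?_
      rw [(sum_eq_zero_iff_of_nonneg fun t _ => X.w_nonneg _ t).1 h0 t ht, zero_mul]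
    · field_simp
  · rw [X.w_eq_zero_of_card hc.ne, zero_mul, mul_zero]
    exact sum_eq_zero fun u _ => by rw [X.w_mul_insert_eq_zero hc u, zero_mul]

theorem sum_agree_w {k : ℕ} (hk : k ≤ d) (S : Finset (Fin k)) (z : Fin k → Fin n) :
    (∑ y with ∀ i ∈ S, y i = z i, X.w k (univ.image y)) * (#S).factorial =
      k.factorial * X.w #S (S.image z) :=
  sum_agree_eq_of_compatible (G := X.w)
    (fun _ hs _ hσ => X.sum_w_insert (hs.trans_le hk) hσ) S z

theorem sum_agree_w_mul {k : ℕ} (hk : k ≤ d) (f : Cf n) (S : Finset (Fin k))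
    (z : Fin k → Fin n) :
    (∑ y with ∀ i ∈ S, y i = z i, X.w k (univ.image y) * f (univ.image y)) * (#S).factorial =
      k.factorial * (X.w #S (S.image z) * Dc X k (k - #S) f (S.image z)) := by
  have key := sum_agree_eq_of_compatible (k := k)
    (G := fun s σ => X.w s σ * Dc X k (k - s) f σ) ?_ S z
  · simpa [Dc] using key
  · intro s hs σ hσ
    rw [X.w_mul_Dop (hs.trans_le hk) hσ]
    obtain ⟨m, rfl⟩ : ∃ m, k = s + 1 + m := ⟨k - (s + 1), by omega⟩
    rw [show s + 1 + m - s = m + 1 by omega, show s + 1 + m - (s + 1) = m by omega, Dc,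
      show s + 1 + m - (m + 1) = s by omega]

end WSC

theorem sum_powersetCard_erase {α : Type*} [DecidableEq α] {m : ℕ} {τ : Finset α}
    (hτ : #τ = m + 1) (F : Finset α → ℝ) :
    ∑ σ ∈ powersetCard m τ, F σ = ∑ v ∈ τ, F (τ.erase v) := by
  symm
  refine sum_nbij (fun v => τ.erase v) ?_ ?_ ?_ fun _ _ => rfl
  · intro v hv
    rw [mem_powersetCard, card_erase_of_mem hv, hτ]
    exact ⟨erase_subset _ _, rfl⟩
  · intro u hu v _ huv
    by_contra hne
    have : u ∈ τ.erase v := mem_erase.2 ⟨hne, hu⟩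
    rw [← show τ.erase u = τ.erase v from huv] at this
    simp at this
  · intro σ hσ
    obtain ⟨hsub, hc⟩ := mem_powersetCard.1 (mem_coe.1 hσ)
    obtain ⟨v, hv⟩ := card_eq_one.1 (by rw [card_sdiff_of_subset hsub]; omega : #(τ \ σ) = 1)
    have hv' : v ∈ τ \ σ := by rw [hv]; simp
    refine ⟨v, mem_coe.2 (mem_sdiff.1 hv').1, ?_⟩
    change τ.erase v = σ
    rw [erase_eq, ← hv, Finset.sdiff_sdiff_eq_self hsub]

theorem sum_powersetCard_powersetCard {α : Type*} [DecidableEq α] {j m : ℕ} {τ : Finset α}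
    (hτ : #τ = j + m + 1) (g : Finset α → ℝ) :
    ∑ σ ∈ powersetCard (j + m) τ, ∑ t ∈ powersetCard j σ, g t =
      (m + 1) * ∑ t ∈ powersetCard j τ, g t := by
  rw [sum_powersetCard_erase hτ,
    sum_comm' (t' := powersetCard j τ) (s' := fun t => τ \ t), mul_sum]
  · refine sum_congr rfl fun t ht => ?_
    obtain ⟨hsub, hc⟩ := mem_powersetCard.1 ht
    rw [sum_const, card_sdiff_of_subset hsub, nsmul_eq_mul, hτ, hc,
      show j + m + 1 - j = m + 1 by omega]
    push_cast
    ring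
  · intro v t
    simp only [mem_powersetCard, mem_sdiff, subset_erase]
    tauto

namespace WSC

variable {n d : ℕ} (X : WSC n d)

theorem mem_faces_of_subset {j : ℕ} (hj : j ≤ d) {s t : Finset (Fin n)} (ht : t ∈ X.faces j)
    (hst : s ⊆ t) : s ∈ X.faces #s := by
  induction j generalizing t with
  | zero =>
    have h0 := X.card_mem 0 t ht
    obtain rfl : t = ∅ := card_eq_zero.1 h0
    obtain rfl : s = ∅ := subset_empty.1 hst
    simpa using ht
  | succ j ih =>
    have hc := X.card_mem _ t ht
    by_cases hcard : #s = j + 1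
    · obtain rfl := eq_of_subset_of_card_le hst (by omega)
      rwa [hcard]
    · obtain ⟨v, hv, hvs⟩ : ∃ v ∈ t, v ∉ s := by
        by_contra! h
        exact hcard (by rw [hst.antisymm h, hc])
      refine ih (by omega) (t := t.erase v) ?_ (subset_erase.2 ⟨hst, hvs⟩)
      refine (X.downward j (by omega) _).2 ⟨?_, t, ht, erase_subset _ _⟩
      rw [card_erase_of_mem hv, hc]; rfl

theorem choose_mul_Uc {j m : ℕ} (hd : j + m ≤ d) (g : Cf n) {τ : Finset (Fin n)}
    (hτ : τ ∈ X.faces (j + m)) :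
    ((j + m).choose j : ℝ) * Uc X j m g τ = ∑ σ ∈ powersetCard j τ, g σ := by
  induction m generalizing τ with
  | zero =>
    have hc := X.card_mem _ τ hτ
    rw [add_zero] at hc
    subst hc
    simp [Uc]
  | succ m ih =>
    have hc : #τ = j + m + 1 := X.card_mem _ τ hτ
    have hfil : (X.faces (j + m)).filter (fun σ => σ ⊆ τ) = powersetCard (j + m) τ := by
      ext σ
      rw [mem_filter, mem_powersetCard]
      constructor
      · rintro ⟨h1, h2⟩
        exact ⟨h2, X.card_mem _ σ h1⟩
      · rintro ⟨h1, h2⟩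
        exact ⟨h2 ▸ X.mem_faces_of_subset hd hτ h1, h1⟩
    have h1 : ((j + m).choose j : ℝ) * ∑ σ ∈ powersetCard (j + m) τ, Uc X j m g σ =
        (m + 1) * ∑ t ∈ powersetCard j τ, g t := by
      rw [← sum_powersetCard_powersetCard hc, mul_sum]
      refine sum_congr rfl fun σ hσ => ih (by omega) ?_
      rw [← hfil] at hσ
      exact (mem_filter.1 hσ).1
    rw [Uc, Uop, hfil]
    have h2 : (((j + m).choose j * (j + m + 1) : ℕ) : ℝ) =
        ((j + m + 1).choose j * (j + m + 1 - j) : ℕ) := by rw [Nat.choose_mul_succ_eq]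
    rw [show j + m + 1 - j = m + 1 by omega] at h2
    push_cast at h2 ⊢
    have h3 : ((j + m).choose j : ℝ) ≠ 0 := by
      exact_mod_cast (Nat.choose_pos (Nat.le_add_right j m)).ne'
    have h4 : ((m : ℝ) + 1) ≠ 0 := by positivity
    have h5 : ((j : ℝ) + m + 1) ≠ 0 := by positivity
    rw [← add_assoc]
    set A := ∑ σ ∈ powersetCard (j + m) τ, Uc X j m g σ
    apply mul_left_cancel₀ h4
    rw [← h1]
    field_simp
    linear_combination -A * h2

/-- Ordered faces: tuples of vertices spanning a `k`-face. -/
abbrev Ordered (k : ℕ) := {x : Fin k → Fin n // univ.image x ∈ X.faces k}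

/-- The system of conditional expectations on uniformly ordered random faces. -/
noncomputable def ordered (k : ℕ) : CondSystem (X.Ordered k) k :=
  CondSystem.ofCoords (fun x => X.w k (univ.image x.1) / k.factorial)
    (fun x => div_pos (X.w_pos k _ x.2) (by positivity)) Subtype.val Subtype.val_injective

variable {X} {k : ℕ}

theorem Ordered.injective (x : X.Ordered k) : Function.Injective x.1 := by
  rw [← Set.injOn_univ, ← coe_univ, ← card_image_iff, X.card_mem k _ x.2, card_univ,
    Fintype.card_fin]

theorem Ordered.card_image (x : X.Ordered k) (S : Finset (Fin k)) : #(S.image x.1) = #S :=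
  card_image_of_injective S x.injective

theorem Ordered.image_mem_faces (hk : k ≤ d) (x : X.Ordered k) (S : Finset (Fin k)) :
    S.image x.1 ∈ X.faces #S :=
  x.card_image S ▸ X.mem_faces_of_subset hk x.2 (image_subset_image (subset_univ S))

variable (X)

theorem sum_agree_ordered (S : Finset (Fin k)) (x : X.Ordered k) (h : (Fin k → Fin n) → ℝ) :
    ∑ y ∈ CondSystem.agree Subtype.val S x, (X.ordered k).μ y * h y.1 =
      (∑ y with ∀ i ∈ S, y i = x.1 i, X.w k (univ.image y) * h y) / k.factorial := by
  rw [sum_div]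
  refine sum_of_injOn Subtype.val Subtype.val_injective.injOn ?_ ?_ ?_
  · intro y hy
    simpa using CondSystem.mem_agree.1 (mem_coe.1 hy)
  · intro y hy hnot
    rw [X.w_zero, zero_mul, zero_div]
    intro hf
    exact hnot ⟨⟨y, hf⟩, mem_coe.2 (CondSystem.mem_agree.2 (mem_filter.1 hy).2), rfl⟩
  · intro y _
    change X.w k (univ.image y.1) / k.factorial * h y.1 = _
    ring

theorem cond_ordered_apply (S : Finset (Fin k)) (x : X.Ordered k) (h : (Fin k → Fin n) → ℝ) :
    (X.ordered k).cond S (fun y => h y.1) x =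
      (∑ y with ∀ i ∈ S, y i = x.1 i, X.w k (univ.image y) * h y) /
        ∑ y with ∀ i ∈ S, y i = x.1 i, X.w k (univ.image y) := by
  have h1 : (X.ordered k).cond S (fun y => h y.1) x =
    (∑ y ∈ CondSystem.agree Subtype.val S x, (X.ordered k).μ y * h y.1) /
      ∑ y ∈ CondSystem.agree Subtype.val S x, (X.ordered k).μ y := rfl
  have h2 := X.sum_agree_ordered S x 1
  simp only [Pi.one_apply, mul_one] at h2
  rw [h1, X.sum_agree_ordered, h2, div_div_div_cancel_right₀]
  positivity

theorem cond_ordered_image (hk : k ≤ d) (f : Cf n) (S : Finset (Fin k)) (x : X.Ordered k) :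
    (X.ordered k).cond S (fun y => f (univ.image y.1)) x =
      Dc X k (k - #S) f (S.image x.1) := by
  rw [X.cond_ordered_apply S x (fun y => f (univ.image y))]
  have h1 := X.sum_agree_w hk S x.1
  have h2 := X.sum_agree_w_mul hk f S x.1
  have h3 := X.w_pos _ _ (x.image_mem_faces hk S)
  have h4 : (0 : ℝ) < k.factorial := by positivity
  have h5 : ((#S).factorial : ℝ) ≠ 0 := by positivity
  have h6 : ∑ y with ∀ i ∈ S, y i = x.1 i, X.w k (univ.image y) ≠ 0 := by
    intro h0
    rw [h0, zero_mul] at h1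
    exact (mul_pos h4 h3).ne h1
  rw [div_eq_iff h6]
  apply mul_right_cancel₀ h5
  linear_combination h2 - Dc X k (k - #S) f (S.image x.1) * h1

theorem cond_ordered_image_eq_linkMean (f : Cf n) (S : Finset (Fin k)) (x : X.Ordered k) :
    (X.ordered k).cond S (fun y => f (univ.image y.1)) x = linkMean X k (S.image x.1) f := by
  rw [X.cond_ordered_apply S x (fun y => f (univ.image y)),
    sum_agree_image (h := fun t => X.w k t * f t)
      (fun t ht => by rw [X.w_eq_zero_of_card ht, zero_mul]) (x.card_image S),
    sum_agree_image (h := X.w k) (fun t => X.w_eq_zero_of_card) (x.card_image S),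
    mul_div_mul_left _ _ (by positivity), sum_w_mul_superset, sum_w_superset, linkMean]

theorem ex_ordered_image (f : Cf n) :
    (X.ordered k).ex (fun y => f (univ.image y.1)) = EE X k f := by
  rw [CondSystem.ex_apply]
  rcases isEmpty_or_nonempty (X.Ordered k) with hE | ⟨⟨x⟩⟩
  · rw [univ_eq_empty, sum_empty, EE]
    refine (sum_eq_zero fun τ hτ => ?_).symm
    refine (hE.false ⟨τ.orderEmbOfFin (X.card_mem k τ hτ), ?_⟩).elim
    rw [image_orderEmbOfFin_univ]
    exact hτ
  · have h1 := X.sum_agree_ordered ∅ x (fun y => f (univ.image y))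
    rw [sum_agree_image (h := fun t => X.w k t * f t)
      (fun t ht => by rw [X.w_eq_zero_of_card ht, zero_mul]) (x.card_image ∅),
      sum_w_mul_superset] at h1
    have h2 : CondSystem.agree Subtype.val ∅ x = univ := by
      ext; simp [CondSystem.mem_agree]
    rw [h2] at h1
    rw [h1, EE]
    have h3 : (k.factorial : ℝ) ≠ 0 := by positivity
    simp [h3]

theorem noiseOp_image (hk : k ≤ d) (ρ : ℝ) (f : Cf n) (x : X.Ordered k) :
    noiseOp X k ρ f (univ.image x.1) = ∑ S : Finset (Fin k), ρ ^ #S * (1 - ρ) ^ (k - #S) *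
      (X.ordered k).cond S (fun y => f (univ.image y.1)) x := by
  have h1 : ∀ j ∈ range (k + 1), ((k.choose (k - j) : ℝ) * (1 - ρ) ^ (k - j) * ρ ^ (k - (k - j))) *
      Uc X (k - (k - j)) (k - j) (Dc X k (k - j) f) (univ.image x.1) =
      ∑ S ∈ powersetCard j univ, ρ ^ #S * (1 - ρ) ^ (k - #S) *
        (X.ordered k).cond S (fun y => f (univ.image y.1)) x := by
    intro j hj
    obtain ⟨m, rfl⟩ : ∃ m, k = j + m := ⟨k - j, by have := mem_range.1 hj; omega⟩
    have h2 := X.choose_mul_Uc hk (Dc X (j + m) m f) x.2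
    have h3 : univ.image x.1 = univ.map ⟨x.1, x.injective⟩ := by rw [map_eq_image]; rfl
    rw [show j + m - j = m by omega, show j + m - m = j by omega,
      ← Nat.choose_symm_of_eq_add (rfl : j + m = j + m)]
    have h4 : ∑ S ∈ powersetCard j univ, ρ ^ #S * (1 - ρ) ^ (j + m - #S) *
        (X.ordered (j + m)).cond S (fun y => f (univ.image y.1)) x =
        ρ ^ j * (1 - ρ) ^ m * ∑ σ ∈ powersetCard j (univ.image x.1), Dc X (j + m) m f σ := by
      rw [h3, powersetCard_map, sum_map, mul_sum]
      refine sum_congr rfl fun S hS => ?_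
      rw [X.cond_ordered_image hk, (mem_powersetCard.1 hS).2, show j + m - j = m by omega]
      congr 2
      change _ = S.map ⟨x.1, x.injective⟩
      rw [map_eq_image]; rfl
    rw [h4, ← h2]
    ring
  rw [noiseOp, Finset.sum_apply]
  simp only [Pi.smul_apply, smul_eq_mul]
  rw [← sum_range_reflect]
  simp only [Nat.add_sub_cancel]
  have h5 := sum_powerset (univ : Finset (Fin k)) (fun S => ρ ^ #S * (1 - ρ) ^ (k - #S) *
      (X.ordered k).cond S (fun y => f (univ.image y.1)) x)
  rw [powerset_univ, card_univ, Fintype.card_fin] at h5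
  rw [h5]
  exact sum_congr rfl h1

theorem stab_eq_sum (hk : k ≤ d) (ρ : ℝ) (f : Cf n) :
    stab X k ρ f = ∑ S : Finset (Fin k), ρ ^ #S * (1 - ρ) ^ (k - #S) *
      (X.ordered k).ex ((fun y => f (univ.image y.1)) *
        (X.ordered k).cond S (fun y => f (univ.image y.1))) := by
  have h1 : stab X k ρ f = EE X k (f * noiseOp X k ρ f) := by
    simp only [stab, ip, EE, Pi.mul_apply, mul_assoc]
  have h2 : (fun y : X.Ordered k => (f * noiseOp X k ρ f) (univ.image y.1)) =
      ∑ S : Finset (Fin k), (ρ ^ #S * (1 - ρ) ^ (k - #S)) • ((fun y => f (univ.image y.1)) *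
        (X.ordered k).cond S (fun y => f (univ.image y.1))) := by
    ext x
    simp only [Pi.mul_apply, X.noiseOp_image hk, Finset.sum_apply, Pi.smul_apply, smul_eq_mul, mul_sum]
    exact sum_congr rfl fun S _ => by ring
  rw [h1, ← X.ex_ordered_image, h2, map_sum]
  simp only [map_smul, smul_eq_mul]

end WSC

namespace WSC

variable {n d : ℕ} (X : WSC n d) {k : ℕ}

theorem edgeW_eq {s : ℕ} {σ : Finset (Fin n)} (hσ : #σ = s) (u v : Fin n) :
    edgeW X s σ u v = X.w (s + 2) (insert u (insert v σ)) := by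
  rw [edgeW]
  split_ifs with h
  · rfl
  · by_contra hne
    have hf : insert u (insert v σ) ∈ X.faces (s + 2) := by
      by_contra hf
      exact hne (X.w_zero _ _ hf).symm
    have hc := X.card_mem _ _ hf
    have hv : v ∉ σ := fun hv => by
      rw [insert_eq_of_mem hv] at hc
      have := card_insert_le u σ
      omega
    have hu : u ∉ insert v σ := fun hu => by
      rw [insert_eq_of_mem hu] at hc
      have := card_insert_le v σ
      omega
    rw [mem_insert, not_or] at hu
    exact h ⟨hu.1, hu.2, hv, hf⟩

theorem edgeW_comm (s : ℕ) (σ : Finset (Fin n)) (u v : Fin n) :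
    edgeW X s σ u v = edgeW X s σ v u := by
  simp only [edgeW, insert_comm u v, ne_comm (a := u), and_left_comm (a := u ∉ σ)]

theorem sum_sum_edgeW_left (s : ℕ) (σ : Finset (Fin n)) (φ : Fin n → ℝ) :
    ∑ u, ∑ v, edgeW X s σ u v * φ u = ∑ u, vertW X s σ u * φ u := by
  simp only [vertW, sum_mul]

theorem sum_sum_edgeW_right (s : ℕ) (σ : Finset (Fin n)) (φ : Fin n → ℝ) :
    ∑ u, ∑ v, edgeW X s σ u v * φ v = ∑ u, vertW X s σ u * φ u := by
  rw [sum_comm, ← sum_sum_edgeW_left]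
  exact sum_congr rfl fun u _ => sum_congr rfl fun v _ => by rw [X.edgeW_comm]

variable {X}

/-- Two centred functions on the vertices of a link are weakly correlated along its edges. -/
theorem _root_.IsLSE.sum_edgeW_mul_le {γ : ℝ} (hX : IsLSE X γ) {s : ℕ} (hs : s + 2 ≤ d)
    {σ : Finset (Fin n)} (hσ : σ ∈ X.faces s) {φ ψ : Fin n → ℝ}
    (hφ : ∑ u, vertW X s σ u * φ u = 0) (hψ : ∑ u, vertW X s σ u * ψ u = 0) :
    ∑ u, ∑ v, edgeW X s σ u v * (φ u * ψ v) ≤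
      γ / 2 * (∑ u, vertW X s σ u * φ u ^ 2 + ∑ u, vertW X s σ u * ψ u ^ 2) := by
  have h1 := (abs_le.1 (hX s hs σ hσ (φ + ψ) (by
    simp only [Pi.add_apply, mul_add, sum_add_distrib, hφ, hψ, add_zero]))).2
  have h2 := (abs_le.1 (hX s hs σ hσ (φ - ψ) (by
    simp only [Pi.sub_apply, mul_sub, sum_sub_distrib, hφ, hψ, sub_zero]))).1
  have h3 : ∑ u, ∑ v, edgeW X s σ u v * (φ u * ψ v) =
      ∑ u, ∑ v, edgeW X s σ u v * (ψ u * φ v) := by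
    rw [sum_comm]
    refine sum_congr rfl fun u _ => sum_congr rfl fun v _ => ?_
    rw [X.edgeW_comm]
    ring
  have h4 : ∑ u, ∑ v, edgeW X s σ u v * (φ + ψ) u * (φ + ψ) v -
      ∑ u, ∑ v, edgeW X s σ u v * (φ - ψ) u * (φ - ψ) v =
      2 * ∑ u, ∑ v, edgeW X s σ u v * (φ u * ψ v) +
        2 * ∑ u, ∑ v, edgeW X s σ u v * (ψ u * φ v) := by
    simp only [mul_sum, ← sum_sub_distrib, ← sum_add_distrib, Pi.add_apply, Pi.sub_apply]
    exact sum_congr rfl fun u _ => sum_congr rfl fun v _ => by ring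
  have h5 : ∑ u, vertW X s σ u * (φ + ψ) u ^ 2 + ∑ u, vertW X s σ u * (φ - ψ) u ^ 2 =
      2 * (∑ u, vertW X s σ u * φ u ^ 2 + ∑ u, vertW X s σ u * ψ u ^ 2) := by
    simp only [mul_sum, ← sum_add_distrib, Pi.add_apply, Pi.sub_apply]
    exact sum_congr rfl fun u _ => by ring
  linear_combination (1 / 4) * h1 + (1 / 4) * h2 - (1 / 4) * h4 + (γ / 4) * h5 + (1 / 2) * h3

variable (X)

theorem sum_agree_pair (hk : k ≤ d) {S : Finset (Fin k)} {i j : Fin k} (hi : i ∉ S) (hj : j ∉ S)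
    (hij : i ≠ j) (x : X.Ordered k) (F : Fin n → Fin n → ℝ) :
    (∑ y with ∀ l ∈ S, y l = x.1 l, X.w k (univ.image y) * F (y i) (y j)) *
        (#S + 2).factorial =
      k.factorial * ∑ u, ∑ v, edgeW X #S (S.image x.1) u v * F u v := by
  have hj' : j ∉ insert i S := by simp [hj, hij.symm]
  rw [sum_agree_eq_sum_update hi, sum_mul, mul_sum]
  refine sum_congr rfl fun u _ => ?_
  rw [sum_agree_eq_sum_update hj', sum_mul, mul_sum]
  refine sum_congr rfl fun v _ => ?_
  have h1 := X.sum_agree_w hk (insert j (insert i S))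
    (Function.update (Function.update x.1 i u) j v)
  rw [image_update_insert hj', image_update_insert hi, card_insert_of_notMem hj',
    card_insert_of_notMem hi] at h1
  rw [X.edgeW_eq (x.card_image S), insert_comm u v, ← mul_assoc, ← h1, mul_right_comm]
  congr 1
  rw [sum_mul]
  refine sum_congr rfl fun y hy => ?_
  have hy' := (mem_filter.1 hy).2
  have hyi := hy' i (by simp)
  have hyj := hy' j (by simp)
  rw [Function.update_of_ne hij, Function.update_self] at hyi
  rw [Function.update_self] at hyj
  rw [hyi, hyj]

theorem exists_cond_pair_eq (hk : k ≤ d) {S : Finset (Fin k)} {i j : Fin k} (hi : i ∉ S)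
    (hj : j ∉ S) (hij : i ≠ j) (x : X.Ordered k) :
    ∃ c : ℝ, 0 < c ∧ ∀ F : Fin n → Fin n → ℝ,
      (X.ordered k).cond S (fun y => F (y.1 i) (y.1 j)) x =
        c * ∑ u, ∑ v, edgeW X #S (S.image x.1) u v * F u v := by
  set B := ∑ y with ∀ l ∈ S, y l = x.1 l, X.w k (univ.image y) with hB
  have hB0 : 0 < B := sum_pos' (fun y _ => X.w_nonneg _ _)
    ⟨x.1, by simp, X.w_pos k _ x.2⟩
  refine ⟨k.factorial / ((#S + 2).factorial * B), by positivity, fun F => ?_⟩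
  rw [X.cond_ordered_apply S x (fun y => F (y i) (y j)), ← hB]
  have h1 := X.sum_agree_pair hk hi hj hij x F
  have h2 : ((#S + 2).factorial : ℝ) ≠ 0 := by positivity
  field_simp
  linear_combination h1

theorem cond_ordered_congr {S : Finset (Fin k)} {x : X.Ordered k} {g h : X.Ordered k → ℝ}
    (H : ∀ y ∈ CondSystem.agree Subtype.val S x, g y = h y) :
    (X.ordered k).cond S g x = (X.ordered k).cond S h x := by
  change CondSystem.coordCond _ _ S g x = CondSystem.coordCond _ _ S h x
  rw [CondSystem.coordCond_apply, CondSystem.coordCond_apply]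
  congr 1
  exact sum_congr rfl fun y hy => by rw [H y hy]

theorem exists_eq_comp_coord {S : Finset (Fin k)} {i : Fin k} {g : X.Ordered k → ℝ}
    (hg : (X.ordered k).Meas (insert i S) g) (x : X.Ordered k) :
    ∃ φ : Fin n → ℝ, ∀ y ∈ CondSystem.agree Subtype.val S x, g y = φ (y.1 i) := by
  classical
  refine ⟨fun u => if h : ∃ y ∈ CondSystem.agree Subtype.val S x, y.1 i = u then g h.choose else 0,
    fun y hy => ?_⟩
  have h : ∃ y' ∈ CondSystem.agree Subtype.val S x, y'.1 i = y.1 i := ⟨y, hy, rfl⟩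
  dsimp only
  rw [dif_pos h, ← hg]
  refine CondSystem.coordCond_congr (CondSystem.mem_agree.2 fun l hl => ?_) g
  rcases mem_insert.1 hl with rfl | hl
  · exact h.choose_spec.2.symm
  · rw [CondSystem.mem_agree.1 hy l hl, CondSystem.mem_agree.1 h.choose_spec.1 l hl]

variable {X}

theorem _root_.IsLSE.ex_mul_le {γ : ℝ} (hX : IsLSE X γ) (hk : k ≤ d) {S : Finset (Fin k)} {i j : Fin k}
    (hi : i ∉ S) (hj : j ∉ S) (hij : i ≠ j) {g h : X.Ordered k → ℝ}
    (hg : (X.ordered k).Meas (insert i S) g) (hh : (X.ordered k).Meas (insert j S) h)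
    (hg0 : (X.ordered k).cond S g = 0) (hh0 : (X.ordered k).cond S h = 0) :
    (X.ordered k).ex (g * h) ≤
      γ / 2 * ((X.ordered k).ex (g * g) + (X.ordered k).ex (h * h)) := by
  set M := X.ordered k
  rw [← M.ex_cond S (g * h), ← M.ex_cond S (g * g), ← M.ex_cond S (h * h), ← map_add,
    ← smul_eq_mul (γ / 2), ← map_smul]
  refine M.ex_mono fun x => ?_
  obtain ⟨φ, hφ⟩ := X.exists_eq_comp_coord hg x
  obtain ⟨ψ, hψ⟩ := X.exists_eq_comp_coord hh x
  obtain ⟨c, hc, H⟩ := X.exists_cond_pair_eq hk hi hj hij x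
  have hcard : #S + 2 ≤ d := by
    have h1 := card_le_univ (insert j (insert i S))
    rw [card_insert_of_notMem (by simp [hj, hij.symm]), card_insert_of_notMem hi,
      Fintype.card_fin] at h1
    omega
  have hφ0 : ∑ u, vertW X #S (S.image x.1) u * φ u = 0 := by
    have h1 := H fun u _ => φ u
    rw [sum_sum_edgeW_left, ← X.cond_ordered_congr hφ] at h1
    have h2 : (X.ordered k).cond S g x = 0 := congrFun hg0 x
    rw [h2] at h1
    exact (mul_eq_zero.1 h1.symm).resolve_left hc.ne'
  have hψ0 : ∑ u, vertW X #S (S.image x.1) u * ψ u = 0 := by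
    have h1 := H fun _ v => ψ v
    rw [sum_sum_edgeW_right, ← X.cond_ordered_congr hψ] at h1
    have h2 : (X.ordered k).cond S h x = 0 := congrFun hh0 x
    rw [h2] at h1
    exact (mul_eq_zero.1 h1.symm).resolve_left hc.ne'
  have key := hX.sum_edgeW_mul_le hcard (x.image_mem_faces hk S) hφ0 hψ0
  have e1 : M.cond S (g * h) x = c * ∑ u, ∑ v, edgeW X #S (S.image x.1) u v * (φ u * ψ v) := by
    rw [← H fun u v => φ u * ψ v]
    exact X.cond_ordered_congr fun y hy => by rw [Pi.mul_apply, hφ y hy, hψ y hy]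
  have e2 : M.cond S (g * g) x = c * ∑ u, vertW X #S (S.image x.1) u * φ u ^ 2 := by
    rw [← X.sum_sum_edgeW_left _ _ (fun u => φ u ^ 2), ← H fun u _ => φ u ^ 2]
    exact X.cond_ordered_congr fun y hy => by rw [Pi.mul_apply, hφ y hy, sq]
  have e3 : M.cond S (h * h) x = c * ∑ u, vertW X #S (S.image x.1) u * ψ u ^ 2 := by
    rw [← X.sum_sum_edgeW_right _ _ (fun u => ψ u ^ 2), ← H fun _ v => ψ v ^ 2]
    exact X.cond_ordered_congr fun y hy => by rw [Pi.mul_apply, hψ y hy, sq]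
  rw [Pi.smul_apply, Pi.add_apply, e1, e2, e3, smul_eq_mul]
  nlinarith [mul_le_mul_of_nonneg_left key hc.le]

theorem _root_.IsLSE.isApprox_ordered {γ : ℝ} (hX : IsLSE X γ) (hγ : 0 ≤ γ) (hk : k ≤ d) :
    (X.ordered k).IsApprox ((k : ℝ) ^ 2 * γ) :=
  (X.ordered k).isApprox_of_single hγ fun _ _ _ hi hj hij =>
    CondSystem.nrm_cond_cond_sub_le_of_corr hγ fun _ _ hg hh hg0 hh0 =>
      hX.ex_mul_le hk hi hj hij hg hh hg0 hh0

variable (X)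

theorem normInf_le_one_of_isBool {f : Cf n} (hf : IsBool X k f) : normInf X k f ≤ 1 := by
  refine Real.iSup_le (fun τ => ?_) zero_le_one
  rcases hf τ.1 τ.2 with h | h <;> simp [h]

theorem spread_ordered (hk : k ≤ d) {f : Cf n} (hf : IsBool X k f) {δ : ℝ} (hδ : 0 ≤ δ) {r : ℕ}
    (hr : r ≤ k) (hps : Pseudorandom X k δ r f) :
    (X.ordered k).Spread (fun y => f (univ.image y.1)) r δ where
  bool := by
    ext y
    rcases hf _ y.2 with h | h <;> simp [h]
  nonneg := hδ
  le_dim := hr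
  cond_le T hT := by
    obtain ⟨R, hTR, hR⟩ := exists_superset_card_eq hT.le (by simpa using hr)
    rw [← (X.ordered k).cond_cond_of_subset _ hTR]
    refine (X.ordered k).cond_le_const T fun x => ?_
    rw [cond_ordered_image_eq_linkMean]
    calc linkMean X k (R.image x.1) f ≤ δ * normInf X k f :=
          (le_abs_self _).trans (hps _ (hR ▸ x.image_mem_faces hk R)).1
      _ ≤ δ := mul_le_of_le_one_right hδ (X.normInf_le_one_of_isBool hf)

end WSC

theorem three_le_and_pow_le_of_log {ρ ε : ℝ} (hρ0 : 0 < ρ) (hρ1 : ρ < 1) (hε0 : 0 < ε)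
    (hε1 : ε < 1) {r : ℕ} (hr : Real.log (2 / ε) / Real.log (1 / ρ) + 2 ≤ r) :
    3 ≤ r ∧ ρ ^ r ≤ ε / 2 := by
  have h1 : 0 < Real.log (1 / ρ) := Real.log_pos (by rw [lt_div_iff₀ hρ0]; linarith)
  have h2 : 0 < Real.log (2 / ε) := Real.log_pos (by rw [lt_div_iff₀ hε0]; linarith)
  have h3 : 0 < Real.log (2 / ε) / Real.log (1 / ρ) := div_pos h2 h1
  refine ⟨?_, ?_⟩
  · have : (2 : ℝ) < r := by linarith
    exact_mod_cast this
  · have h4 : Real.log (2 / ε) ≤ r * Real.log (1 / ρ) := by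
      rw [← div_le_iff₀ h1]; linarith
    rw [← Real.log_le_log_iff (by positivity) (by positivity), Real.log_pow]
    have h5 : Real.log (1 / ρ) = -Real.log ρ := by rw [one_div, Real.log_inv]
    have h6 : Real.log (2 / ε) = -Real.log (ε / 2) := by rw [← Real.log_inv, inv_div]
    rw [h5, h6] at h4
    linarith

theorem stab_le_of_isLSE {n d : ℕ} {X : WSC n d} {γ : ℝ} (hγ : 0 ≤ γ) (hX : IsLSE X γ) {k : ℕ}
    (hk : k ≤ d) {ρ ε : ℝ} (hρ0 : 0 ≤ ρ) (hρ1 : ρ ≤ 1) (hε0 : 0 < ε) {r : ℕ}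
    (hr : 3 ≤ r) (hρr : ρ ^ r ≤ ε / 2) (hrk : r ≤ k) {f : Cf n} (hf : IsBool X k f) {δ : ℝ}
    (hδ0 : 0 ≤ δ) (hδ : δ * 2 ^ (20 * r) ≤ ε ^ 3) (hps : Pseudorandom X k δ r f) :
    stab X k ρ f ≤ (ε + 2 ^ (22 * k) * γ) * EE X k f := by
  have hS := X.spread_ordered hk hf hδ0 hrk hps
  have hE : 0 ≤ EE X k f := by
    refine sum_nonneg fun τ hτ => mul_nonneg (X.w_nonneg _ _) ?_
    rcases hf τ hτ with h | h <;> simp [h]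
  have hA : 0 ≤ 2 ^ (22 * k) * γ := by positivity
  set ε' := max ε (2 ^ (22 * k) * γ) with hε'
  have hεε' : ε ≤ ε' := le_max_left _ _
  have hle : ε' ≤ ε + 2 ^ (22 * k) * γ := max_le (by linarith) (by linarith)
  refine le_trans ?_ (mul_le_mul_of_nonneg_right hle hE)
  rw [X.stab_eq_sum hk, ← X.ex_ordered_image]
  rw [← X.ex_ordered_image] at hE
  rcases le_total ε' 1 with h1 | h1
  · refine hS.sum_noise_le_mul (hX.isApprox_ordered hγ hk) (by positivity) hρ0 hρ1
      (hε0.trans_le hεε') h1 hr (hδ.trans (by gcongr)) ?_ (hρr.trans (by gcongr))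
    have h2 : (k : ℝ) ≤ 2 ^ k := by exact_mod_cast Nat.lt_two_pow_self.le
    have h3 : (4 : ℝ) ≤ 2 ^ k := by
      calc (4 : ℝ) = 2 ^ 2 := by norm_num
        _ ≤ 2 ^ k := pow_le_pow_right₀ (by norm_num) (by omega)
    calc 4 * (2 ^ k) ^ 19 * ((k : ℝ) ^ 2 * γ) ≤ 2 ^ k * (2 ^ k) ^ 19 * ((2 ^ k) ^ 2 * γ) := by
          gcongr
      _ = 2 ^ (22 * k) * γ := by rw [mul_comm 22 k, pow_mul]; ring
      _ ≤ ε' := le_max_right _ _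
  · exact ((X.ordered k).sum_noise_le_ex hS.bool hρ0 hρ1).trans (le_mul_of_one_le_left hE h1)

/-- pseudorandom functions are noise sensitive: there exist
universal constants `a, C > 0` such that on any two-sided `γ`-local-spectral
expander, for `ρ, ε ∈ (0,1)`, an integer `r ≥ log(2/ε)/log(1/ρ) + 2` (with `r ≤ k`
so that `(δ,r)`-pseudorandomness of `f ∈ C_k` is meaningful), and a Boolean
`(δ,r)`-pseudorandom `f ∈ C_k` with `δ ≤ 2^{−ar}·ε³`:
`Stab_ρ(f) ≤ (ε + 2^{Ck}·γ)·E[f]`. -/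
theorem stmt17 : ∃ a C : ℝ, 0 < a ∧ 0 < C ∧
    ∀ (n d : ℕ) (X : WSC n d) (γ : ℝ), 0 ≤ γ → IsLSE X γ →
    ∀ (k : ℕ), k ≤ d → ∀ (ρ ε : ℝ), 0 < ρ → ρ < 1 → 0 < ε → ε < 1 →
    ∀ (r : ℕ), Real.log (2/ε) / Real.log (1/ρ) + 2 ≤ (r:ℝ) → r ≤ k →
    ∀ (f : Cf n), IsBool X k f → ∀ (δ : ℝ), 0 ≤ δ →
    δ ≤ (2:ℝ) ^ (-(a * (r:ℝ))) * ε^3 → Pseudorandom X k δ r f →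
    stab X k ρ f ≤ (ε + (2:ℝ) ^ (C * (k:ℝ)) * γ) * EE X k f := by
  refine ⟨20, 22, by norm_num, by norm_num, ?_⟩
  intro n d X γ hγ hX k hk ρ ε hρ0 hρ1 hε0 hε1 r hr hrk f hf δ hδ0 hδ hps
  obtain ⟨hr3, hρr⟩ := three_le_and_pow_le_of_log hρ0 hρ1 hε0 hε1 hr
  have h1 : (2 : ℝ) ^ ((22 : ℝ) * k) = 2 ^ (22 * k) := by
    rw [← Real.rpow_natCast]; push_cast; rfl
  have h2 : (2 : ℝ) ^ ((20 : ℝ) * r) = 2 ^ (20 * r) := by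
    rw [← Real.rpow_natCast]; push_cast; rfl
  rw [Real.rpow_neg (by norm_num), h2, inv_mul_eq_div, le_div_iff₀ (by positivity)] at hδ
  rw [h1]
  exact stab_le_of_isLSE hγ hX hk hρ0.le hρ1.le hε0 hr3 hρr hrk hf hδ0 hδ hps
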